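/- arXiv:1909.13549 — 3 statements merged into one kernel-verified Lean document; each statement's English description precedes it below -/
import Mathlib

section
/- There exist constants δ_f' > 0, C > 0 and x₀ > 0 depending only on f with the following property: for every x ∈ (0, x₀), every positive divisor δ of Π_f, and all positive integers a, k such that pδ ∤ Π_f for every prime p dividing k and such that k ≤ x^{−1/(2r)}, one has Σ_{n ≥ 0, n ≡ a·f(0) (mod δ)} |p_f(a, δk; n) − p_f(n)/k|² e^{−2nx} ≤ C · G_f(x)² · exp(−2 δ_f' k^{−2} x^{−1/r}). -/
/-- The parts of the partition `π` all lie in `{f ℓ : ℓ ≥ 1}`. -/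
def PartsIn (f : ℤ → ℤ) {n : ℕ} (π : n.Partition) : Prop :=
  ∀ i ∈ π.parts, ∃ ℓ : ℤ, 1 ≤ ℓ ∧ (i : ℤ) = f ℓ

/-- `pf f n` : number of partitions of `n` with all parts in `{f ℓ : ℓ ≥ 1}`. -/
noncomputable def pf (f : ℤ → ℤ) (n : ℕ) : ℕ :=
  Nat.card {π : n.Partition // PartsIn f π}

/-- `pfm f m n` : number of such partitions of `n` with exactly `m` parts. -/
noncomputable def pfm (f : ℤ → ℤ) (m n : ℕ) : ℕ :=
  Nat.card {π : n.Partition // PartsIn f π ∧ Multiset.card π.parts = m}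

/-- `pfa f a k n = Σ_{m ≥ 0, m ≡ a (mod k)} pfm f m n`; note that `pfm f m n = 0`
for `m > n`, so the sum may be truncated at `m = n`. -/
noncomputable def pfa (f : ℤ → ℤ) (a k n : ℕ) : ℕ :=
  ∑ m ∈ Finset.range (n + 1), if m % k = a % k then pfm f m n else 0


/-- The generating function `G_f(x) = ∏_{n ≥ 1} (1 - e^{-f(n)x})⁻¹`. -/
noncomputable def Gf (f : ℤ → ℤ) (x : ℝ) : ℝ :=
  ∏' n : ℕ, (1 - Real.exp (-(f ((n : ℤ) + 1) : ℝ) * x))⁻¹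


/-- `y` lies within `κ` of an integer. -/
def Near (y κ : ℝ) : Prop := ∃ n : ℤ, |y - n| ≤ κ

lemma Near.mono {y κ κ' : ℝ} (h : Near y κ) (hk : κ ≤ κ') : Near y κ' := by
  obtain ⟨n, hn⟩ := h
  exact ⟨n, hn.trans hk⟩

lemma Near.add {y z κ κ' : ℝ} (h : Near y κ) (h' : Near z κ') : Near (y + z) (κ + κ') := by
  obtain ⟨n, hn⟩ := h
  obtain ⟨m, hm⟩ := h'
  refine ⟨n + m, ?_⟩
  push_cast
  calc |y + z - (n + m)| = |(y - n) + (z - m)| := by ring_nf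
    _ ≤ _ := (abs_add_le _ _).trans (add_le_add hn hm)

lemma Near.zero : Near 0 0 := ⟨0, by simp⟩

lemma Near.int_mul {y κ : ℝ} (c : ℤ) (h : Near y κ) : Near (c * y) (|(c : ℝ)| * κ) := by
  obtain ⟨n, hn⟩ := h
  refine ⟨c * n, ?_⟩
  push_cast
  rw [← mul_sub, abs_mul]
  exact mul_le_mul_of_nonneg_left hn (abs_nonneg _)

lemma Near.add_int {y κ : ℝ} (h : Near y κ) (m : ℤ) : Near (y + m) κ := by
  obtain ⟨n, hn⟩ := h
  refine ⟨n + m, ?_⟩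
  push_cast
  simpa using hn

lemma Near.add_small {y z κ κ' : ℝ} (h : Near y κ) (h' : |z| ≤ κ') : Near (y + z) (κ + κ') :=
  h.add ⟨0, by simpa using h'⟩

lemma Near.sum {ι : Type*} (s : Finset ι) (c : ι → ℤ) (y : ι → ℝ) (κ : ℝ)
    (h : ∀ i ∈ s, Near (y i) κ) :
    Near (∑ i ∈ s, (c i : ℝ) * y i) ((∑ i ∈ s, |(c i : ℝ)|) * κ) := by
  classical
  induction s using Finset.induction_on with
  | empty => simpa using Near.zero
  | insert a s ha ih =>
    rw [Finset.sum_insert ha, Finset.sum_insert ha, add_mul]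
    exact ((h a (by simp)).int_mul _).add (ih fun i hi => h i (by simp [hi]))

open fwdDiff in
lemma fd_poly (r : ℕ) (P : Polynomial ℚ) (hPdeg : P.natDegree = r)
    (l h : ℚ) (hh : h ≠ 0) :
    ∑ i ∈ Finset.range (r + 1), ((-1 : ℚ) ^ (r - i) * (r.choose i : ℚ)) * P.eval (l + i * h)
      = (P.leadingCoeff * r.factorial) * h ^ r := by
  set Q := P.comp (Polynomial.C h * Polynomial.X + Polynomial.C l) with hQ
  have hlin : (Polynomial.C h * Polynomial.X + Polynomial.C l).natDegree = 1 :=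
    Polynomial.natDegree_linear hh
  have hdeg : Q.natDegree = r := by
    rw [hQ, Polynomial.natDegree_comp, hlin, hPdeg, mul_one]
  have hlc : Q.leadingCoeff = P.leadingCoeff * h ^ r := by
    rw [hQ, Polynomial.leadingCoeff_comp (by rw [hlin]; simp), hPdeg,
      Polynomial.leadingCoeff_linear hh]
  have key := congrFun (Polynomial.fwdDiff_iter_degree_eq_factorial Q) 0
  rw [fwdDiff_iter_eq_sum_shift, hdeg, hlc] at key
  calc _ = _ := by
        refine Finset.sum_congr rfl fun i _ => ?_
        simp only [hQ, Polynomial.eval_comp, zsmul_eq_mul]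
        push_cast
        congr 2
        simp
        ring
    _ = _ := key
    _ = _ := by simp [Pi.smul_apply]; ring

lemma fd_int (r : ℕ) (P : Polynomial ℚ) (hPdeg : P.natDegree = r)
    (hPlc : 0 < P.leadingCoeff)
    (f : ℤ → ℤ) (hfP : ∀ ℓ : ℤ, (f ℓ : ℚ) = P.eval (ℓ : ℚ)) :
    ∃ D : ℤ, 0 < D ∧ ∀ l h : ℤ, h ≠ 0 →
      ∑ i ∈ Finset.range (r + 1), ((-1 : ℤ) ^ (r - i) * (r.choose i : ℤ)) * f (l + i * h)
        = D * h ^ r := by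
  have key : ∀ l h : ℤ, h ≠ 0 →
      ((∑ i ∈ Finset.range (r + 1), ((-1 : ℤ) ^ (r - i) * (r.choose i : ℤ)) * f (l + i * h) : ℤ) : ℚ)
        = (P.leadingCoeff * r.factorial) * (h : ℚ) ^ r := by
    intro l h hh
    rw [← fd_poly r P hPdeg l h (by exact_mod_cast hh)]
    push_cast
    refine Finset.sum_congr rfl fun i _ => ?_
    rw [hfP]; push_cast; rfl
  set D := ∑ i ∈ Finset.range (r + 1), ((-1 : ℤ) ^ (r - i) * (r.choose i : ℤ)) * f (0 + i * 1) with hD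
  have h1 : (D : ℚ) = P.leadingCoeff * r.factorial := by
    have := key 0 1 one_ne_zero
    rw [← hD] at this
    simpa using this
  refine ⟨D, ?_, ?_⟩
  · have : (0 : ℚ) < D := by rw [h1]; positivity
    exact_mod_cast this
  · intro l h hh
    have := key l h hh
    rw [← h1] at this
    exact_mod_cast this

lemma alt_sum (r : ℕ) (hr : 1 ≤ r) :
    ∑ i ∈ Finset.range (r + 1), ((-1 : ℤ) ^ (r - i) * (r.choose i : ℤ)) = 0 := by
  have := add_pow (1 : ℤ) (-1) r
  simp at this
  rw [zero_pow (by omega)] at this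
  exact this.symm

lemma f_growth (r : ℕ) (P : Polynomial ℚ) (hPdeg : P.natDegree = r)
    (f : ℤ → ℤ) (hfP : ∀ ℓ : ℤ, (f ℓ : ℚ) = P.eval (ℓ : ℚ)) :
    ∃ A : ℝ, 0 < A ∧ ∀ l : ℕ, 1 ≤ l → |(f l : ℝ)| ≤ A * (l : ℝ) ^ r := by
  refine ⟨((∑ i ∈ Finset.range (r + 1), |P.coeff i| : ℚ) : ℝ) + 1, ?_, ?_⟩
  · have : (0 : ℚ) ≤ ∑ i ∈ Finset.range (r + 1), |P.coeff i| :=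
      Finset.sum_nonneg fun i _ => abs_nonneg _
    have h2 : (0 : ℝ) ≤ ((∑ i ∈ Finset.range (r + 1), |P.coeff i| : ℚ) : ℝ) := by exact_mod_cast this
    linarith
  · intro l hl
    have h1 : |(f l : ℚ)| ≤ (∑ i ∈ Finset.range (r + 1), |P.coeff i|) * (l : ℚ) ^ r := by
      rw [hfP, Polynomial.eval_eq_sum_range, hPdeg, Finset.sum_mul]
      refine (Finset.abs_sum_le_sum_abs _ _).trans (Finset.sum_le_sum fun i hi => ?_)
      rw [abs_mul, abs_pow]
      refine mul_le_mul_of_nonneg_left ?_ (abs_nonneg _)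
      have h3 : (1 : ℚ) ≤ l := by exact_mod_cast hl
      simp only [Int.cast_natCast, Nat.abs_cast]
      exact pow_le_pow_right₀ h3 (by simp at hi; omega)
    have h2 : |(f l : ℝ)| ≤ ((∑ i ∈ Finset.range (r + 1), |P.coeff i| : ℚ) : ℝ) * (l : ℝ) ^ r := by
      exact_mod_cast h1
    have h3 : (0 : ℝ) ≤ (l : ℝ) ^ r := by positivity
    nlinarith

lemma f_period (P : Polynomial ℚ)
    (f : ℤ → ℤ) (hfP : ∀ ℓ : ℤ, (f ℓ : ℚ) = P.eval (ℓ : ℚ)) (D : ℤ) (hD : 0 < D) :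
    ∃ N : ℕ, 0 < N ∧ ∀ l m : ℤ, (N : ℤ) ∣ l - m → D ∣ f l - f m := by
  obtain ⟨b, hbM, hb⟩ := IsLocalization.integerNormalization_spec (nonZeroDivisors ℤ) P
  set Q := IsLocalization.integerNormalization (nonZeroDivisors ℤ) P
  have hb0 : (b : ℤ) ≠ 0 := nonZeroDivisors.ne_zero hbM
  have hQ : ∀ l : ℤ, Q.eval l = b * f l := by
    intro l
    have h1 := congrArg (fun R => Polynomial.eval (l : ℚ) R) hb
    simp only [Polynomial.eval_smul] at h1
    have h2 : Polynomial.eval (l : ℚ) (Polynomial.map (algebraMap ℤ ℚ) Q) = (Q.eval l : ℤ) := by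
      simp [Polynomial.eval_map]
    rw [h2, ← hfP] at h1
    have : ((Q.eval l : ℤ) : ℚ) = ((b * f l : ℤ) : ℚ) := by
      rw [h1]; simp [zsmul_eq_mul]
    exact_mod_cast this
  refine ⟨((b : ℤ) * D).natAbs, by positivity, ?_⟩
  intro l m hlm
  have h1 : (b : ℤ) * D ∣ l - m := by
    rwa [Int.natCast_natAbs, abs_dvd] at hlm
  have h2 : (b : ℤ) * D ∣ b * (f l - f m) := by
    have := h1.trans (Polynomial.sub_dvd_eval_sub l m Q)
    rw [hQ, hQ, ← mul_sub] at this
    exact this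
  exact (mul_dvd_mul_iff_left hb0).1 h2

lemma near_Pi (f : ℤ → ℤ) (Pif : ℕ)
    (hPif : ∀ d : ℕ, d ∣ Pif ↔ ∀ ℓ : ℤ, (d : ℤ) ∣ (f ℓ - f 0)) :
    ∃ K : ℝ, 0 < K ∧ ∀ α θ κ : ℝ, 0 ≤ κ → (∀ l : ℤ, Near (α + f l * θ) κ) →
      Near (Pif * α) (K * κ) := by
  have hspan : (Pif : ℤ) ∈ Ideal.span (Set.range fun l => f l - f 0) := by
    set I := Ideal.span (Set.range fun l => f l - f 0) with hI
    obtain ⟨g, hg⟩ := (IsPrincipalIdealRing.principal I).principal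
    have hg' : I = Ideal.span {g} := hg
    have h1 : ∀ l, g ∣ f l - f 0 := by
      intro l
      rw [← Ideal.mem_span_singleton, ← hg']
      exact Ideal.subset_span ⟨l, rfl⟩
    have h2 : g.natAbs ∣ Pif := (hPif _).2 fun l => by
      rw [Int.natCast_natAbs, abs_dvd]; exact h1 l
    rw [hg', Ideal.mem_span_singleton]
    exact Int.natAbs_dvd.1 (by exact_mod_cast h2)
  have hK : ∃ K : ℝ, 0 ≤ K ∧ ∀ α θ κ : ℝ, 0 ≤ κ → (∀ l : ℤ, Near (α + f l * θ) κ) →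
      Near (((Pif : ℤ) : ℝ) * θ) (K * κ) := by
    refine Submodule.span_induction (p := fun (d : ℤ) _ => ∃ K : ℝ, 0 ≤ K ∧ ∀ α θ κ : ℝ, 0 ≤ κ →
      (∀ l : ℤ, Near (α + f l * θ) κ) → Near ((d : ℝ) * θ) (K * κ)) ?_ ?_ ?_ ?_ hspan
    · rintro _ ⟨l, rfl⟩
      refine ⟨2, by norm_num, fun α θ κ hκ h => ?_⟩
      have := (h l).add ((h 0).int_mul (-1))
      refine (by convert this using 1; push_cast; ring : Near _ _).mono ?_
      simp; linarith
    · exact ⟨0, le_rfl, fun α θ κ _ _ => by simpa using Near.zero⟩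
    · rintro x y _ _ ⟨K, hK, h⟩ ⟨K', hK', h'⟩
      refine ⟨K + K', by positivity, fun α θ κ hκ hh => ?_⟩
      convert (h α θ κ hκ hh).add (h' α θ κ hκ hh) using 1 <;> push_cast <;> ring
    · rintro a x _ ⟨K, hK, h⟩
      refine ⟨|(a : ℝ)| * K, by positivity, fun α θ κ hκ hh => ?_⟩
      convert (h α θ κ hκ hh).int_mul a using 1
      · simp [mul_assoc]
      · ring
  obtain ⟨K, hK, h⟩ := hK
  refine ⟨Pif + |(f 0 : ℝ)| * K + 1, by positivity, fun α θ κ hκ hh => ?_⟩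
  have h1 := ((hh 0).int_mul Pif).add ((h α θ κ hκ hh).int_mul (-(f 0)))
  refine (by convert h1 using 1; push_cast; ring : Near _ _).mono ?_
  push_cast
  rw [abs_neg, Nat.abs_cast]
  nlinarith


lemma shift_lemma (L : ℕ) (B T : Finset ℕ) (hTB : T.card * B.card < L / 2) :
    ∃ l, 1 ≤ l ∧ l ≤ L / 2 ∧ ∀ t ∈ T, l + t ∉ B := by
  classical
  by_contra hcon
  push Not at hcon
  have hsub : Finset.Icc 1 (L / 2) ⊆ (T ×ˢ B).image fun p => p.2 - p.1 := by
    intro l hl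
    rw [Finset.mem_Icc] at hl
    obtain ⟨t, ht, hb⟩ := hcon l hl.1 hl.2
    rw [Finset.mem_image]
    exact ⟨(t, l + t), by simp [ht, hb], by simp⟩
  have h1 := (Finset.card_le_card hsub).trans Finset.card_image_le
  rw [Finset.card_product, Nat.card_Icc] at h1
  omega

lemma dioph (r : ℕ) (hr : 1 ≤ r) (P : Polynomial ℚ) (hPdeg : P.natDegree = r)
    (hPlc : 0 < P.leadingCoeff)
    (f : ℤ → ℤ) (hfP : ∀ ℓ : ℤ, (f ℓ : ℚ) = P.eval (ℓ : ℚ)) (Pif : ℕ)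
    (hPif : ∀ d : ℕ, d ∣ Pif ↔ ∀ ℓ : ℤ, (d : ℤ) ∣ (f ℓ - f 0)) :
    ∃ (ε η : ℝ) (L₀ : ℕ), 0 < ε ∧ ε ≤ 1 / 8 ∧ 0 < η ∧ ∀ L : ℕ, L₀ ≤ L → ∀ k : ℝ, 1 ≤ k → ∀ α θ : ℝ,
      ¬ Near (Pif * α) (1 / (2 * k)) → ∀ B : Finset ℕ,
      (∀ l, 1 ≤ l → l ≤ L → l ∉ B → Near (α + f l * θ) (ε / k)) → η * L ≤ B.card := by
  obtain ⟨D, hD, hfd⟩ := fd_int r P hPdeg hPlc f hfP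
  obtain ⟨A, hA, hgrow⟩ := f_growth r P hPdeg f hfP
  obtain ⟨N, hN, hper⟩ := f_period P f hfP D hD
  obtain ⟨K, hK, hnear⟩ := near_Pi f Pif hPif
  have hr0 : (0 : ℝ) < r := by exact_mod_cast hr
  set M : ℝ := 1 + 2 ^ r * A * (4 * r) ^ r with hM
  have hMpos : 0 < M := by positivity
  set ε : ℝ := min (1 / 8) (min (1 / (2 * K * M)) (1 / (2 * (2 ^ r + 1) * 2 ^ r))) with hε
  have hεpos : 0 < ε := by positivity
  have hε1 : ε ≤ 1 / 8 := min_le_left _ _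
  have hε2 : K * M * ε ≤ 1 / 2 := by
    have : ε ≤ 1 / (2 * K * M) := (min_le_right _ _).trans (min_le_left _ _)
    rw [le_div_iff₀ (by positivity)] at this
    linarith
  have hε3 : (2 ^ r + 1) * 2 ^ r * ε ≤ 1 / 2 := by
    have : ε ≤ 1 / (2 * (2 ^ r + 1) * 2 ^ r) := (min_le_right _ _).trans (min_le_right _ _)
    rw [le_div_iff₀ (by positivity)] at this
    linarith
  refine ⟨ε, 1 / (4 * (r + 1 + N)), 4 * r + 2 * N + 2, hεpos, hε1, by positivity, ?_⟩
  intro L hL k hk α θ hα B hB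
  by_contra hcard
  push Not at hcard
  apply hα
  have hk0 : 0 < k := by linarith
  -- cardinality bounds
  have hcard' : (B.card : ℝ) * (4 * (r + 1 + N)) < L := by
    rw [div_mul_eq_mul_div, one_mul, lt_div_iff₀ (by positivity)] at hcard
    exact hcard
  have hcardN : B.card * (4 * (r + 1 + N)) < L := by exact_mod_cast hcard'
  have hT : ∀ T : Finset ℕ, T.card ≤ r + 1 + N → T.card * B.card < L / 2 := by
    intro T hTc
    have : T.card * B.card ≤ (r + 1 + N) * B.card := Nat.mul_le_mul_right _ hTc
    have h2 : 4 * ((r + 1 + N) * B.card) < L := by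
      calc _ = B.card * (4 * (r + 1 + N)) := by ring
        _ < L := hcardN
    omega
  set H := L / 2 / r with hH
  have hHr : H * r ≤ L / 2 := Nat.div_mul_le_self _ _
  set κ : ℝ := 2 ^ r * (ε / k) with hκ
  have hκ0 : 0 ≤ κ := by positivity
  have hεk : ε / k ≤ ε := div_le_self hεpos.le hk
  have hκ1 : (2 ^ r + 1) * κ < 1 := by
    have : (2 ^ r + 1) * κ ≤ (2 ^ r + 1) * 2 ^ r * ε := by
      rw [hκ, ← mul_assoc]
      exact mul_le_mul_of_nonneg_left hεk (by positivity)
    linarith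
  -- differences
  have hdiff : ∀ h : ℕ, 1 ≤ h → h ≤ H → Near ((D : ℝ) * (h : ℝ) ^ r * θ) κ := by
    intro h h1 h2
    obtain ⟨l, hl1, hl2, hl⟩ := shift_lemma L B ((Finset.range (r + 1)).image fun i => i * h)
      (hT _ (Finset.card_image_le.trans (by simp)))
    have hn : ∀ i ∈ Finset.range (r + 1), Near (α + f ((l : ℤ) + i * (h : ℤ)) * θ) (ε / k) := by
      intro i hi
      have hi' : i ≤ r := by simp at hi; omega
      have hih : i * h ≤ L / 2 := (by nlinarith : i * h ≤ H * r).trans hHr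
      have := hB (l + i * h) (by omega) (by omega) (hl _ (Finset.mem_image_of_mem _ hi))
      push_cast at this
      exact this
    have hs := Near.sum (Finset.range (r + 1)) (fun i => (-1 : ℤ) ^ (r - i) * (r.choose i : ℤ))
      _ (ε / k) hn
    have e1 : ∑ i ∈ Finset.range (r + 1), (((-1 : ℤ) ^ (r - i) * (r.choose i : ℤ) : ℤ) : ℝ) *
        (α + f ((l : ℤ) + i * (h : ℤ)) * θ) = (D : ℝ) * (h : ℝ) ^ r * θ := by
      have a1 : ((∑ i ∈ Finset.range (r + 1), ((-1 : ℤ) ^ (r - i) * (r.choose i : ℤ)) : ℤ) : ℝ) = 0 := by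
        rw [alt_sum r hr]; simp
      have a2 : ((∑ i ∈ Finset.range (r + 1), ((-1 : ℤ) ^ (r - i) * (r.choose i : ℤ)) *
          f ((l : ℤ) + i * (h : ℤ)) : ℤ) : ℝ) = D * (h : ℝ) ^ r := by
        rw [hfd l h (by omega)]; push_cast; rfl
      rw [← a2]
      calc _ = ((∑ i ∈ Finset.range (r + 1), ((-1 : ℤ) ^ (r - i) * (r.choose i : ℤ)) : ℤ) : ℝ) * α +
          ((∑ i ∈ Finset.range (r + 1), ((-1 : ℤ) ^ (r - i) * (r.choose i : ℤ)) *
          f ((l : ℤ) + i * (h : ℤ)) : ℤ) : ℝ) * θ := by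
            rw [Int.cast_sum, Int.cast_sum, Finset.sum_mul, Finset.sum_mul,
              ← Finset.sum_add_distrib]
            refine Finset.sum_congr rfl fun i _ => ?_
            push_cast
            ring
        _ = _ := by rw [a1]; ring
    have e2 : ∑ i ∈ Finset.range (r + 1), |(((-1 : ℤ) ^ (r - i) * (r.choose i : ℤ) : ℤ) : ℝ)|
        = 2 ^ r := by
      have := Nat.sum_range_choose r
      have h3 : ((∑ i ∈ Finset.range (r + 1), r.choose i : ℕ) : ℝ) = 2 ^ r := by
        rw [this]; push_cast; rfl
      rw [← h3]
      push_cast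
      refine Finset.sum_congr rfl fun i _ => ?_
      rw [abs_mul, abs_pow]
      simp
    rw [e1, e2] at hs
    exact hs
  have hHreal : (L : ℝ) ≤ 4 * r * H := by
    have h1 : L / 2 < r * (H + 1) := by
      have := Nat.lt_mul_div_succ (L / 2) (by omega : 0 < r)
      exact this
    have : L ≤ 4 * r * H := by nlinarith [Nat.div_add_mod L 2, Nat.mod_lt L (by norm_num : 2 > 0)]
    exact_mod_cast this
  have hH1 : 1 ≤ H := by
    rw [hH]
    exact (Nat.one_le_div_iff (by omega)).2 (by omega)
  obtain ⟨n, hn⟩ := hdiff 1 le_rfl hH1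
  set β : ℝ := D * θ - n with hβ
  have hβ1 : |β| ≤ κ := by simpa [hβ] using hn
  have hboot : ∀ h : ℕ, 1 ≤ h → h ≤ H → (h : ℝ) ^ r * |β| ≤ κ := by
    intro h h1
    induction h, h1 using Nat.le_induction with
    | base => intro _; simpa using hβ1
    | succ h h1 ih =>
      intro h2
      have ih' := ih (by omega)
      have h1' : (1 : ℝ) ≤ h := by exact_mod_cast h1
      obtain ⟨m, hm⟩ := hdiff (h + 1) (by omega) h2
      have hsmall : ((h + 1 : ℕ) : ℝ) ^ r * |β| ≤ 2 ^ r * κ := by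
        calc ((h + 1 : ℕ) : ℝ) ^ r * |β| ≤ (2 * h) ^ r * |β| := by
              gcongr
              push_cast
              linarith
          _ = 2 ^ r * ((h : ℝ) ^ r * |β|) := by rw [mul_pow]; ring
          _ ≤ _ := by gcongr
      set y : ℝ := ((h + 1 : ℕ) : ℝ) ^ r * β with hy
      have hyabs : |y| = ((h + 1 : ℕ) : ℝ) ^ r * |β| := by
        rw [hy, abs_mul, abs_of_nonneg (by positivity)]
      set m' : ℤ := m - (h + 1 : ℕ) ^ r * n with hm'
      have hm2 : |y - m'| ≤ κ := by
        convert hm using 2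
        rw [hy, hβ, hm']
        push_cast
        ring
      have hm0 : |(m' : ℝ)| < 1 := by
        have : (m' : ℝ) = y - (y - m') := by ring
        rw [this]
        refine (abs_sub _ _).trans_lt ?_
        rw [hyabs]
        linarith
      have : m' = 0 := by
        have h5 : |m'| < 1 := by exact_mod_cast hm0
        exact Int.abs_lt_one_iff.1 h5
      rw [this] at hm2
      rw [← hyabs]
      simpa using hm2
  have hβL : (L : ℝ) ^ r * |β| ≤ (4 * r) ^ r * κ := by
    calc (L : ℝ) ^ r * |β| ≤ (4 * r * H) ^ r * |β| := by gcongr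
      _ = (4 * r) ^ r * ((H : ℝ) ^ r * |β|) := by rw [mul_pow]; ring
      _ ≤ _ := by gcongr; exact hboot H hH1 le_rfl
  -- window
  obtain ⟨l₀, hl1, hl2, hl⟩ := shift_lemma L B (Finset.range N) (hT _ (by simp))
  have hD1 : (1 : ℝ) ≤ D := by exact_mod_cast hD
  have hwin : ∀ i : ℕ, i < N → Near (α + f ((l₀ + i : ℕ) : ℤ) * ((n : ℝ) / D)) (M * (ε / k)) := by
    intro i hi
    have h1 := hB (l₀ + i) (by omega) (by omega) (hl i (by simpa using hi))
    have h2 : |-(f ((l₀ + i : ℕ) : ℤ) * (β / D))| ≤ A * ((4 * r) ^ r * κ) := by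
      rw [abs_neg, abs_mul, abs_div, abs_of_pos (by linarith : (0 : ℝ) < D)]
      have h3 := hgrow (l₀ + i) (by omega)
      have h4 : ((l₀ + i : ℕ) : ℝ) ^ r ≤ (L : ℝ) ^ r := by
        gcongr
        omega
      calc |(f ((l₀ + i : ℕ) : ℤ) : ℝ)| * (|β| / D) ≤ (A * (L : ℝ) ^ r) * |β| := by
            apply mul_le_mul (h3.trans (by gcongr)) (div_le_self (abs_nonneg _) hD1) (by positivity)
              (by positivity)
        _ = A * ((L : ℝ) ^ r * |β|) := by ring
        _ ≤ _ := by gcongr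
    have h3 := h1.add_small h2
    convert h3 using 1
    · have : (D : ℝ) ≠ 0 := by linarith
      have hθ : θ = n / D + β / D := by rw [hβ]; field_simp; ring
      conv_rhs => rw [hθ]
      ring
    · rw [hM, hκ]; ring
  have hall : ∀ l : ℤ, Near (α + f l * ((n : ℝ) / D)) (M * (ε / k)) := by
    intro l
    have hNz : (0 : ℤ) < N := by exact_mod_cast hN
    have hmod := Int.emod_nonneg (l - l₀) hNz.ne'
    have hmod2 := Int.emod_lt_of_pos (l - l₀) hNz
    set i := ((l - l₀) % N).toNat with hi
    have hi' : (i : ℤ) = (l - l₀) % N := Int.toNat_of_nonneg hmod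
    have h1 := hwin i (by omega)
    obtain ⟨c, hc⟩ := hper l ((l₀ + i : ℕ) : ℤ) (by
      push_cast
      rw [hi', ← sub_sub]
      exact Int.dvd_self_sub_emod)
    have h2 := h1.add_int (c * n)
    convert h2 using 1
    have : (D : ℝ) ≠ 0 := by linarith
    have hc' : (f l : ℝ) = f ((l₀ + i : ℕ) : ℤ) + D * c := by
      have : f l = f ((l₀ + i : ℕ) : ℤ) + D * c := by linarith
      exact_mod_cast this
    rw [hc']
    push_cast
    field_simp
    ring
  refine (hnear α _ _ (by positivity) hall).mono ?_
  rw [← mul_assoc, ← mul_div_assoc, div_le_div_iff₀ hk0 (by positivity)]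
  nlinarith


lemma bessel_bound (c : ℕ → ℂ) (hc : Summable fun n => ‖c n‖) (M : ℝ) (hM : 0 ≤ M)
    (h : ∀ θ : ℝ, ‖∑' n : ℕ, c n * Complex.exp (2 * Real.pi * Complex.I * n * θ)‖ ≤ M) (N : ℕ) :
    ∑ n ∈ Finset.range N, ‖c n‖ ^ 2 ≤ M ^ 2 := by
  have : Fact ((0 : ℝ) < 1) := ⟨one_pos⟩
  have hs : Summable fun n : ℕ => c n • (fourier (n : ℤ) : C(AddCircle (1 : ℝ), ℂ)) := by
    apply Summable.of_norm
    simpa [norm_smul, fourier_norm] using hc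
  set F : C(AddCircle (1 : ℝ), ℂ) := ∑' n : ℕ, c n • (fourier (n : ℤ) : C(AddCircle (1 : ℝ), ℂ)) with hF
  have hFnorm : ‖F‖ ≤ M := by
    rw [ContinuousMap.norm_le _ hM]
    intro x
    induction x using QuotientAddGroup.induction_on with
    | H θ =>
      have h1 : F (θ : AddCircle (1 : ℝ)) = ∑' n : ℕ, c n * Complex.exp (2 * Real.pi * Complex.I * n * θ) := by
        rw [hF, ← ContinuousMap.tsum_apply hs]
        refine tsum_congr fun n => ?_
        rw [ContinuousMap.smul_apply, fourier_coe_apply, smul_eq_mul]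
        simp
      exact h1 ▸ h θ
  set Φ := (ContinuousMap.toLp (E := ℂ) 2 (AddCircle.haarAddCircle (T := (1 : ℝ))) ℂ) with hΦ
  have hΦnorm : ‖Φ F‖ ≤ M := by
    refine (Φ.le_opNorm F).trans ?_
    have h1 : ‖Φ‖ ≤ 1 := by
      refine (ContinuousMap.toLp_norm_le _).trans ?_
      simp [MeasureTheory.measureUnivNNReal]
    calc ‖Φ‖ * ‖F‖ ≤ 1 * M := mul_le_mul h1 hFnorm (norm_nonneg _) zero_le_one
      _ = M := one_mul _
  have horth := orthonormal_fourier (T := (1 : ℝ))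
  have hinner : ∀ n : ℕ, inner ℂ (fourierLp 2 (n : ℤ)) (Φ F) = c n := by
    intro n
    have h1 : HasSum (fun m : ℕ => inner ℂ (fourierLp (T := (1 : ℝ)) 2 (n : ℤ)) (Φ (c m • (fourier (m : ℤ))))) (inner ℂ (fourierLp 2 (n : ℤ)) (Φ F)) := by
      have h2 := (hs.hasSum.mapL Φ).mapL (innerSL ℂ (fourierLp (T := (1 : ℝ)) 2 (n : ℤ)))
      exact h2
    rw [← h1.tsum_eq, tsum_eq_single n]
    · rw [map_smul, inner_smul_right]
      have : Φ (fourier (n : ℤ)) = fourierLp 2 (n : ℤ) := rfl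
      rw [this, inner_self_eq_norm_sq_to_K, horth.1]
      simp
    · intro m hm
      rw [map_smul, inner_smul_right]
      have : Φ (fourier (m : ℤ)) = fourierLp 2 (m : ℤ) := rfl
      rw [this, horth.2 (by exact_mod_cast hm.symm), mul_zero]
  have hb := horth.sum_inner_products_le (x := Φ F) (s := (Finset.range N).map Nat.castEmbedding)
  rw [Finset.sum_map] at hb
  simp only [Nat.castEmbedding_apply, hinner] at hb
  refine hb.trans ?_
  gcongr

/-- The power series `φ` converges absolutely at `q` with value `v`. -/
def Ev (φ : PowerSeries ℂ) (q v : ℂ) : Prop :=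
  Summable (fun n => ‖PowerSeries.coeff n φ * q ^ n‖) ∧ ∑' n, PowerSeries.coeff n φ * q ^ n = v

lemma Ev.one (q : ℂ) : Ev 1 q 1 := by
  have h : ∀ n, n ≠ 0 → PowerSeries.coeff n (1 : PowerSeries ℂ) * q ^ n = 0 := by
    intro n hn; simp [PowerSeries.coeff_one, hn]
  refine ⟨?_, ?_⟩
  · apply summable_of_ne_finset_zero (s := {0})
    intro n hn
    rw [h n (by simpa using hn), norm_zero]
  · rw [tsum_eq_single 0 h]; simp

lemma Ev.mul {φ ψ : PowerSeries ℂ} {q v w : ℂ} (h : Ev φ q v) (h' : Ev ψ q w) :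
    Ev (φ * ψ) q (v * w) := by
  have e : ∀ n, PowerSeries.coeff n (φ * ψ) * q ^ n = ∑ kl ∈ Finset.HasAntidiagonal.antidiagonal n,
      (PowerSeries.coeff kl.1 φ * q ^ kl.1) * (PowerSeries.coeff kl.2 ψ * q ^ kl.2) := by
    intro n
    rw [PowerSeries.coeff_mul, Finset.sum_mul]
    refine Finset.sum_congr rfl fun kl hkl => ?_
    rw [← Finset.HasAntidiagonal.mem_antidiagonal.1 hkl, pow_add]
    ring
  have h1 := summable_norm_sum_mul_antidiagonal_of_summable_norm
    (f := fun n => PowerSeries.coeff n φ * q ^ n) (g := fun n => PowerSeries.coeff n ψ * q ^ n) h.1 h'.1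
  have h2 := tsum_mul_tsum_eq_tsum_sum_antidiagonal_of_summable_norm
    (f := fun n => PowerSeries.coeff n φ * q ^ n) (g := fun n => PowerSeries.coeff n ψ * q ^ n) h.1 h'.1
  rw [h.2, h'.2] at h2
  refine ⟨?_, ?_⟩
  · convert h1 using 2 with n
    rw [e n]
  · rw [h2]
    exact tsum_congr e

lemma Ev.prod {ι : Type*} (s : Finset ι) (φ : ι → PowerSeries ℂ) (q : ℂ) (v : ι → ℂ)
    (h : ∀ i ∈ s, Ev (φ i) q (v i)) : Ev (∏ i ∈ s, φ i) q (∏ i ∈ s, v i) := by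
  classical
  induction s using Finset.induction_on with
  | empty => simpa using Ev.one q
  | insert a s ha ih =>
    rw [Finset.prod_insert ha, Finset.prod_insert ha]
    exact (h a (by simp)).mul (ih fun i hi => h i (by simp [hi]))

/-- The geometric series `∑ ζ^j X^(ij)`. -/
noncomputable def geo (ζ : ℂ) (i : ℕ) : PowerSeries ℂ :=
  PowerSeries.mk fun n => if i ∣ n then ζ ^ (n / i) else 0

lemma Ev.geo (ζ q : ℂ) (i : ℕ) (hi : 0 < i) (hζ : ‖ζ‖ = 1) (hq : ‖q‖ < 1) :
    Ev (geo ζ i) q (1 - ζ * q ^ i)⁻¹ := by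
  have hinj : Function.Injective fun j : ℕ => i * j := fun a b hab => Nat.eq_of_mul_eq_mul_left hi hab
  have hsupp : ∀ n, n ∉ Set.range (fun j : ℕ => i * j) → PowerSeries.coeff n (_root_.geo ζ i) * q ^ n = 0 := by
    intro n hn
    have : ¬ i ∣ n := fun ⟨j, hj⟩ => hn ⟨j, hj.symm⟩
    simp [_root_.geo, this]
  have hval : ∀ j, PowerSeries.coeff (i * j) (_root_.geo ζ i) * q ^ (i * j) = (ζ * q ^ i) ^ j := by
    intro j
    simp [_root_.geo, Nat.mul_div_cancel_left _ hi, mul_pow, pow_mul]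
  have hlt : ‖ζ * q ^ i‖ < 1 := by
    rw [norm_mul, hζ, one_mul, norm_pow]
    exact pow_lt_one₀ (norm_nonneg _) hq hi.ne'
  refine ⟨?_, ?_⟩
  · rw [← hinj.summable_iff (fun n hn => by rw [hsupp n hn, norm_zero])]
    simp only [Function.comp_def, hval, norm_pow]
    exact summable_geometric_of_lt_one (norm_nonneg _) hlt
  · rw [← hinj.tsum_eq (f := fun n => PowerSeries.coeff n (_root_.geo ζ i) * q ^ n)]
    · simp only [hval]
      exact tsum_geometric_of_norm_lt_one hlt
    · intro n hn
      by_contra hcon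
      exact hn (hsupp n hcon)

open PowerSeries.WithPiTopology in
open scoped Classical in
lemma genFun_eq (ζ : ℂ) (S : Set ℕ) (N : ℕ) :
    Nat.Partition.genFun (fun i c => if i ∈ S ∧ i ≤ N then ζ ^ c else 0) =
      ∏ i ∈ Finset.range N, if i + 1 ∈ S then geo ζ (i + 1) else 1 := by
  set g : ℕ → ℕ → ℂ := fun i c => if i ∈ S ∧ i ≤ N then ζ ^ c else 0 with hg
  rw [Nat.Partition.genFun_eq_tprod, tprod_eq_prod (s := Finset.range N)]
  · refine Finset.prod_congr rfl fun i hi => ?_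
    have hi' : i + 1 ≤ N := by simp at hi; omega
    split_ifs with hS
    · ext n
      rw [map_add, (Nat.Partition.summable_genFun_term g i).map_tsum _
        (PowerSeries.WithPiTopology.continuous_coeff _ _)]
      simp only [hg, hS, hi', true_and, if_true, geo, PowerSeries.coeff_mk, map_smul,
        PowerSeries.coeff_X_pow, PowerSeries.coeff_one, smul_eq_mul]
      by_cases hd : (i + 1) ∣ n
      · obtain ⟨j, rfl⟩ := hd
        rw [if_pos (dvd_mul_right _ _), Nat.mul_div_cancel_left _ (Nat.succ_pos i)]
        rcases j with _ | j
        · simp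
        · rw [tsum_eq_single j]
          · simp
          · intro b hb
            have : (i + 1) * (j + 1) ≠ (i + 1) * (b + 1) := by
              intro h
              have := Nat.eq_of_mul_eq_mul_left (Nat.succ_pos i) h
              omega
            simp [this]
      · rw [if_neg hd]
        have h0 : n ≠ 0 := by rintro rfl; exact hd (dvd_zero _)
        have : ∀ b, n ≠ (i + 1) * (b + 1) := fun b h => hd ⟨_, h⟩
        simp [h0, this]
    · simp [hg, hS]
  · intro i hi
    have hi' : ¬ i + 1 ≤ N := by simp at hi; omega
    simp [hg, hi']

open scoped Classical in
lemma coeff_genFun_eq (ζ : ℂ) (S : Set ℕ) (N n : ℕ) (hn : n ≤ N) :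
    PowerSeries.coeff n (Nat.Partition.genFun (fun i c => if i ∈ S ∧ i ≤ N then ζ ^ c else 0)) =
      ∑ p : n.Partition, if ∀ i ∈ p.parts, i ∈ S then ζ ^ (Multiset.card p.parts) else 0 := by
  rw [Nat.Partition.coeff_genFun]
  refine Finset.sum_congr rfl fun p _ => ?_
  rw [Finsupp.prod]
  simp only [Multiset.toFinsupp_support, Multiset.toFinsupp_apply]
  split_ifs with h
  · rw [← Multiset.toFinset_sum_count_eq, ← Finset.prod_pow_eq_pow_sum]
    refine Finset.prod_congr rfl fun i hi => ?_
    rw [Multiset.mem_toFinset] at hi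
    have : i ≤ n := by
      have := Multiset.le_sum_of_mem hi
      rwa [p.parts_sum] at this
    rw [if_pos ⟨h i hi, by omega⟩]
  · push Not at h
    obtain ⟨i, hi, hiS⟩ := h
    apply Finset.prod_eq_zero (i := i) (by simpa using hi)
    simp [hiS]

open scoped Classical in
/-- `∑ ζ^(number of parts)` over partitions of `n` with parts in `S`. -/
noncomputable def Az (S : Set ℕ) (ζ : ℂ) (n : ℕ) : ℂ :=
  ∑ p : n.Partition, if ∀ i ∈ p.parts, i ∈ S then ζ ^ (Multiset.card p.parts) else 0

open scoped Classical in
lemma sum_Az_le (S : Set ℕ) (ζ : ℂ) (hζ : ‖ζ‖ = 1) (ρ : ℝ) (hρ : 0 < ρ) (hρ1 : ρ < 1) (N : ℕ)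
    (M : ℝ) (hM : 0 ≤ M)
    (h : ∀ θ : ℝ, ∏ i ∈ Finset.range N, (if i + 1 ∈ S then
      ‖1 - ζ * (ρ * Complex.exp (2 * Real.pi * Complex.I * θ)) ^ (i + 1)‖⁻¹ else 1) ≤ M) :
    ∑ n ∈ Finset.range (N + 1), ‖Az S ζ n‖ ^ 2 * ρ ^ (2 * n) ≤ M ^ 2 := by
  set φ := Nat.Partition.genFun (fun i c => if i ∈ S ∧ i ≤ N then ζ ^ c else 0) with hφ
  have hev : ∀ q : ℂ, ‖q‖ < 1 → Ev φ q (∏ i ∈ Finset.range N,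
      if i + 1 ∈ S then (1 - ζ * q ^ (i + 1))⁻¹ else 1) := by
    intro q hq
    rw [hφ, genFun_eq]
    apply Ev.prod
    intro i _
    split_ifs
    · exact Ev.geo ζ q (i + 1) (Nat.succ_pos i) hζ hq
    · exact Ev.one q
  have hb := bessel_bound (fun n => PowerSeries.coeff n φ * (ρ : ℂ) ^ n)
    (hev ρ (by simpa [abs_of_pos hρ] using hρ1)).1 M hM ?_ (N + 1)
  · refine le_trans (le_of_eq ?_) hb
    refine Finset.sum_congr rfl fun n hn => ?_
    rw [hφ, coeff_genFun_eq ζ S N n (by simp at hn; omega), norm_mul, mul_pow, norm_pow]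
    rw [Complex.norm_real, Real.norm_of_nonneg hρ.le, ← pow_mul, mul_comm n 2]
    rfl
  · intro θ
    have hq : ‖(ρ * Complex.exp (2 * Real.pi * Complex.I * θ) : ℂ)‖ < 1 := by
      rw [norm_mul, Complex.norm_exp]
      simpa [abs_of_pos hρ] using hρ1
    have e := (hev _ hq).2
    have e2 : ∀ n : ℕ, PowerSeries.coeff n φ * (ρ : ℂ) ^ n *
        Complex.exp (2 * Real.pi * Complex.I * n * θ) = PowerSeries.coeff n φ *
          (ρ * Complex.exp (2 * Real.pi * Complex.I * θ)) ^ n := by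
      intro n
      rw [mul_pow, ← Complex.exp_nat_mul, mul_assoc]
      congr 3
      ring
    simp only [e2]
    rw [e, norm_prod]
    refine le_trans (le_of_eq ?_) (h θ)
    refine Finset.prod_congr rfl fun i _ => ?_
    split_ifs
    · rw [norm_inv]
    · simp


lemma f_summable (r : ℕ) (hr : 1 ≤ r) (P : Polynomial ℚ) (hPdeg : P.natDegree = r)
    (hPlc : 0 < P.leadingCoeff)
    (f : ℤ → ℤ) (hfP : ∀ ℓ : ℤ, (f ℓ : ℚ) = P.eval (ℓ : ℚ))
    (hfpos : ∀ ℓ : ℤ, 1 ≤ ℓ → 0 < f ℓ) (x : ℝ) (hx : 0 < x) :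
    Summable fun n : ℕ => Real.exp (-(f ((n : ℤ) + 1) : ℝ) * x) := by
  set Q := P.map (algebraMap ℚ ℝ) with hQ
  have hQd : Q.natDegree = r := by rw [hQ, Polynomial.natDegree_map, hPdeg]
  have hQl : 0 < Q.leadingCoeff := by
    rw [hQ, Polynomial.leadingCoeff_map]
    simpa using hPlc
  have hev : ∀ l : ℤ, Q.eval (l : ℝ) = f l := by
    intro l
    have h1 : ((f l : ℚ) : ℝ) = ((P.eval (l : ℚ) : ℚ) : ℝ) := by rw [hfP]
    have h2 : Polynomial.eval ((algebraMap ℚ ℝ) (l : ℚ)) Q = (algebraMap ℚ ℝ) (P.eval (l : ℚ)) := by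
      rw [hQ, Polynomial.eval_map_apply]
    simp only [eq_ratCast, Rat.cast_intCast] at h2
    rw [h2, ← h1]; simp
  obtain ⟨c, hc, hO⟩ := (Q.isEquivalent_atTop_lead.symm.isBigO).exists_pos
  rw [Asymptotics.isBigOWith_iff] at hO
  have ht : Filter.Tendsto (fun n : ℕ => ((n : ℝ) + 1)) Filter.atTop Filter.atTop :=
    Filter.tendsto_atTop_add_const_right _ _ tendsto_natCast_atTop_atTop
  have hO' := ht.eventually hO
  set b := Q.leadingCoeff / c with hb
  have hb0 : 0 < b := by positivity
  have hexp : Real.exp (-(b * x)) < 1 := by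
    rw [Real.exp_lt_one_iff]; nlinarith [mul_pos hb0 hx]
  refine Summable.of_norm_bounded_eventually_nat
    (summable_geometric_of_lt_one (Real.exp_pos _).le hexp) ?_
  filter_upwards [hO'] with n hn
  rw [Real.norm_of_nonneg (Real.exp_pos _).le, ← Real.exp_nat_mul, Real.exp_le_exp]
  have h1 : Q.eval ((n : ℝ) + 1) = f ((n : ℤ) + 1) := by
    rw [← hev]; push_cast; rfl
  have hpos : (0 : ℝ) < f ((n : ℤ) + 1) := by exact_mod_cast hfpos _ (by omega)
  rw [h1, Real.norm_of_nonneg hpos.le, Real.norm_of_nonneg (by positivity), hQd] at hn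
  have h2 : (n : ℝ) ≤ ((n : ℝ) + 1) ^ r := by
    have : ((n : ℝ) + 1) ≤ ((n : ℝ) + 1) ^ r := le_self_pow₀ (by linarith [Nat.cast_nonneg (α := ℝ) n]) (by omega)
    linarith
  have h3 : b * n ≤ f ((n : ℤ) + 1) := by
    rw [hb, div_mul_eq_mul_div, div_le_iff₀ hc]
    calc Q.leadingCoeff * n ≤ Q.leadingCoeff * ((n : ℝ) + 1) ^ r := by gcongr
      _ ≤ c * f ((n : ℤ) + 1) := hn
      _ = _ := mul_comm _ _
  nlinarith

lemma Gf_multipliable (f : ℤ → ℤ) (hfpos : ∀ ℓ : ℤ, 1 ≤ ℓ → 0 < f ℓ) (x : ℝ) (hx : 0 < x)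
    (hs : Summable fun n : ℕ => Real.exp (-(f ((n : ℤ) + 1) : ℝ) * x)) :
    Multipliable fun n : ℕ => (1 - Real.exp (-(f ((n : ℤ) + 1) : ℝ) * x))⁻¹ := by
  have hle : ∀ n : ℕ, Real.exp (-(f ((n : ℤ) + 1) : ℝ) * x) ≤ Real.exp (-x) := by
    intro n
    have : (1 : ℝ) ≤ f ((n : ℤ) + 1) := by exact_mod_cast hfpos _ (by omega)
    rw [Real.exp_le_exp]; nlinarith
  have h1 : Real.exp (-x) < 1 := by rw [Real.exp_lt_one_iff]; linarith
  have hsum : Summable fun n : ℕ => ‖(1 - Real.exp (-(f ((n : ℤ) + 1) : ℝ) * x))⁻¹ - 1‖ := by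
    refine Summable.of_nonneg_of_le (fun _ => norm_nonneg _) (fun n => ?_)
      (hs.mul_left (1 - Real.exp (-x))⁻¹)
    set y := Real.exp (-(f ((n : ℤ) + 1) : ℝ) * x) with hy
    have hy0 : 0 < y := Real.exp_pos _
    have hy1 := hle n
    have e : (1 - y)⁻¹ - 1 = (1 - y)⁻¹ * y := by
      have : 1 - y ≠ 0 := by linarith
      field_simp; ring
    have hp : 0 < 1 - y := by linarith
    rw [e, Real.norm_of_nonneg (by positivity)]
    gcongr
  have := multipliable_one_add_of_summable hsum
  simpa using this

lemma prod_le_Gf (f : ℤ → ℤ) (hfpos : ∀ ℓ : ℤ, 1 ≤ ℓ → 0 < f ℓ) (x : ℝ) (hx : 0 < x)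
    (hs : Summable fun n : ℕ => Real.exp (-(f ((n : ℤ) + 1) : ℝ) * x)) (T : Finset ℕ)
    (hT : ∀ s ∈ T, ∃ ℓ : ℤ, 1 ≤ ℓ ∧ (s : ℤ) = f ℓ) :
    ∏ s ∈ T, (1 - Real.exp (-x) ^ s)⁻¹ ≤ Gf f x := by
  classical
  have hm := (Gf_multipliable f hfpos x hx hs).hasProd
  have hidx : ∀ s : ℕ, ∃ n : ℕ, s ∈ T → (s : ℤ) = f ((n : ℤ) + 1) := by
    intro s
    by_cases h : s ∈ T
    · obtain ⟨l, hl, hl2⟩ := hT s h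
      refine ⟨(l - 1).toNat, fun _ => ?_⟩
      rw [Int.toNat_of_nonneg (by omega), hl2]
      congr 1; omega
    · exact ⟨0, fun h' => absurd h' h⟩
  choose g hg using hidx
  have hone : ∀ n : ℕ, 1 ≤ (1 - Real.exp (-(f ((n : ℤ) + 1) : ℝ) * x))⁻¹ := by
    intro n
    have hpos : (0 : ℝ) < f ((n : ℤ) + 1) := by exact_mod_cast hfpos _ (by omega)
    have h1 : Real.exp (-(f ((n : ℤ) + 1) : ℝ) * x) < 1 := by
      rw [Real.exp_lt_one_iff]; nlinarith [mul_pos hpos hx]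
    rw [one_le_inv₀ (by linarith)]
    linarith [Real.exp_pos (-(f ((n : ℤ) + 1) : ℝ) * x)]
  have hinj : Set.InjOn g T := by
    intro s hs t ht hst
    have := (hg s hs).trans ((congrArg (fun n : ℕ => f ((n : ℤ) + 1)) hst).trans (hg t ht).symm)
    exact_mod_cast this
  have e : ∏ s ∈ T, (1 - Real.exp (-x) ^ s)⁻¹
      = ∏ n ∈ T.image g, (1 - Real.exp (-(f ((n : ℤ) + 1) : ℝ) * x))⁻¹ := by
    rw [Finset.prod_image hinj]
    refine Finset.prod_congr rfl fun s hs => ?_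
    rw [← hg s hs, ← Real.exp_nat_mul]
    congr 3
    push_cast; ring
  rw [e]
  refine ge_of_tendsto hm ?_
  filter_upwards [Filter.eventually_ge_atTop (T.image g)] with U hU
  exact Finset.prod_le_prod_of_subset_of_one_le hU
    (fun n _ => zero_le_one.trans (hone n)) (fun n _ _ => hone n)

lemma normSq_term (y φ : ℝ) :
    ‖(1 : ℂ) - y * Complex.exp (2 * Real.pi * Complex.I * φ)‖ ^ 2 =
      (1 - y) ^ 2 + 2 * y * (1 - Real.cos (2 * Real.pi * φ)) := by
  have e : (2 * Real.pi * Complex.I * φ : ℂ) = ((2 * Real.pi * φ : ℝ) : ℂ) * Complex.I := by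
    push_cast; ring
  rw [e]
  generalize 2 * Real.pi * φ = u
  have h1 : ((1 : ℂ) - y * Complex.exp (u * Complex.I)).re = 1 - y * Real.cos u := by
    simp [Complex.exp_ofReal_mul_I_re]
  have h2 : ((1 : ℂ) - y * Complex.exp (u * Complex.I)).im = - (y * Real.sin u) := by
    simp [Complex.exp_ofReal_mul_I_im]
  rw [Complex.sq_norm, Complex.normSq_apply, h1, h2]
  linear_combination y ^ 2 * Real.sin_sq_add_cos_sq u

lemma term_ge (y φ : ℝ) (hy : 0 ≤ y) :
    1 - y ≤ ‖(1 : ℂ) - y * Complex.exp (2 * Real.pi * Complex.I * φ)‖ := by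
  apply le_of_sq_le_sq _ (norm_nonneg _)
  rw [normSq_term]
  nlinarith [Real.cos_le_one (2 * Real.pi * φ)]

lemma cos_far (φ κ : ℝ) (hκ : 0 ≤ κ) (h : ¬ Near φ κ) :
    Real.cos (2 * Real.pi * φ) ≤ 1 - 8 * κ ^ 2 := by
  set t := φ - round φ with ht
  have h1 : |t| ≤ 1 / 2 := abs_sub_round φ
  have h2 : κ < |t| := by
    by_contra hcon
    exact h ⟨round φ, not_lt.1 hcon⟩
  have e : Real.cos (2 * Real.pi * φ) = Real.cos (2 * Real.pi * t) := by
    rw [ht, mul_sub, mul_comm (2 * Real.pi) (round φ : ℝ), Real.cos_sub_int_mul_two_pi]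
  have hpi := Real.pi_pos
  have h3 := Real.cos_le_one_sub_mul_cos_sq (x := 2 * Real.pi * t) (by
    rw [abs_mul, abs_of_pos (by positivity)]; nlinarith)
  have e2 : 2 / Real.pi ^ 2 * (2 * Real.pi * t) ^ 2 = 8 * t ^ 2 := by
    field_simp; ring
  rw [e2] at h3
  rw [e]
  have : κ ^ 2 ≤ t ^ 2 := by
    rw [← sq_abs t]; gcongr
  linarith

lemma term_far (y φ κ c₀ : ℝ) (hy1 : y < 1) (hc : 0 < c₀) (hcy : c₀ ≤ y) (hκ : 0 ≤ κ)
    (hκ1 : κ ≤ 1 / 8) (h : ¬ Near φ κ) :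
    (1 - y) * Real.exp (4 * c₀ * κ ^ 2) ≤
      ‖(1 : ℂ) - y * Complex.exp (2 * Real.pi * Complex.I * φ)‖ := by
  have hy : 0 < y := by linarith
  apply le_of_sq_le_sq _ (norm_nonneg _)
  rw [normSq_term, mul_pow, ← Real.exp_nat_mul]
  have hcos := cos_far φ κ hκ h
  set t : ℝ := ((2 : ℕ) : ℝ) * (4 * c₀ * κ ^ 2) with ht
  have ht' : t = 8 * c₀ * κ ^ 2 := by rw [ht]; push_cast; ring
  have hκ2 : κ ^ 2 ≤ 1 / 64 := by nlinarith
  have hct : c₀ * κ ^ 2 ≤ 1 * (1 / 64) := mul_le_mul (by linarith) hκ2 (by positivity) zero_le_one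
  have ht0 : 0 ≤ t := by rw [ht']; positivity
  have ht1 : t ≤ 1 / 2 := by rw [ht']; linarith
  have hexp : Real.exp t ≤ 1 + 2 * t := by
    have h1 : 1 - t ≤ Real.exp (-t) := by linarith [Real.add_one_le_exp (-t)]
    have h2 : Real.exp t * Real.exp (-t) = 1 := by rw [← Real.exp_add]; simp
    have h3 := Real.exp_pos t
    have h4 : Real.exp t * (1 - t) ≤ 1 := by
      calc _ ≤ Real.exp t * Real.exp (-t) := by gcongr
        _ = 1 := h2
    by_contra hcon
    push Not at hcon
    nlinarith
  have h5 : (1 - y) ^ 2 ≤ 1 := by nlinarith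
  have h6 : 2 * y * (8 * κ ^ 2) ≤ 2 * y * (1 - Real.cos (2 * Real.pi * φ)) := by
    gcongr; linarith
  have h7 : 2 * t ≤ 2 * y * (8 * κ ^ 2) := by
    rw [ht']; nlinarith [sq_nonneg κ]
  calc (1 - y) ^ 2 * Real.exp t ≤ (1 - y) ^ 2 * (1 + 2 * t) := by gcongr
    _ ≤ (1 - y) ^ 2 + 2 * t := by nlinarith
    _ ≤ _ := by linarith


lemma fiber_card (r : ℕ) (hr : 1 ≤ r) (P : Polynomial ℚ) (hPdeg : P.natDegree = r)
    (f : ℤ → ℤ) (hfP : ∀ ℓ : ℤ, (f ℓ : ℚ) = P.eval (ℓ : ℚ)) (B : Finset ℕ) (b : ℤ)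
    (hB : ∀ l ∈ B, f (l : ℤ) = b) : B.card ≤ r := by
  classical
  have hdeg : 0 < P.degree := Polynomial.natDegree_pos_iff_degree_pos.1 (by omega)
  have hne : P - Polynomial.C (b : ℚ) ≠ 0 := by
    intro h
    have h1 : P = Polynomial.C (b : ℚ) := sub_eq_zero.1 h
    rw [h1] at hPdeg
    simp at hPdeg
    omega
  calc B.card = (B.image fun l : ℕ => (l : ℚ)).card :=
        (Finset.card_image_of_injective _ Nat.cast_injective).symm
    _ ≤ (P - Polynomial.C (b : ℚ)).roots.toFinset.card := by
        apply Finset.card_le_card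
        intro q hq
        obtain ⟨l, hl, rfl⟩ := Finset.mem_image.1 hq
        rw [Multiset.mem_toFinset, Polynomial.mem_roots hne]
        have h1 := hfP l
        rw [hB l hl] at h1
        simp [Polynomial.IsRoot, h1]
    _ ≤ Multiset.card (P - Polynomial.C (b : ℚ)).roots := Multiset.toFinset_card_le _
    _ ≤ P.natDegree := Polynomial.card_roots_sub_C' hdeg
    _ = r := hPdeg

/-- The set of allowed parts. -/
def partSet (f : ℤ → ℤ) : Set ℕ := {n | ∃ ℓ : ℤ, 1 ≤ ℓ ∧ (n : ℤ) = f ℓ}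

open scoped Classical in
lemma sup_bound (r : ℕ) (hr : 1 ≤ r) (P : Polynomial ℚ) (hPdeg : P.natDegree = r)
    (hPlc : 0 < P.leadingCoeff)
    (f : ℤ → ℤ) (hfP : ∀ ℓ : ℤ, (f ℓ : ℚ) = P.eval (ℓ : ℚ))
    (hfpos : ∀ ℓ : ℤ, 1 ≤ ℓ → 0 < f ℓ) (Pif : ℕ)
    (hPif : ∀ d : ℕ, d ∣ Pif ↔ ∀ ℓ : ℤ, (d : ℤ) ∣ (f ℓ - f 0)) :
    ∃ c x₀ : ℝ, 0 < c ∧ 0 < x₀ ∧ ∀ x : ℝ, 0 < x → x < x₀ → 0 ≤ Gf f x ∧ ∃ N₀ : ℕ, ∀ k : ℕ, 0 < k →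
      ∀ α : ℝ, ¬ Near (Pif * α) (1 / (2 * k)) → ∀ N, N₀ ≤ N → ∀ θ : ℝ,
      ∏ i ∈ Finset.range N, (if i + 1 ∈ partSet f then
        ‖1 - Complex.exp (2 * Real.pi * Complex.I * α) *
          ((Real.exp (-x) : ℝ) * Complex.exp (2 * Real.pi * Complex.I * θ)) ^ (i + 1)‖⁻¹ else 1)
        ≤ Gf f x * Real.exp (-(c / (k : ℝ) ^ 2 * x ^ (-(1 : ℝ) / r))) := by
  obtain ⟨ε, η, L₀, hε, hε1, hη, hdio⟩ := dioph r hr P hPdeg hPlc f hfP Pif hPif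
  obtain ⟨A, hA, hgrow⟩ := f_growth r P hPdeg f hfP
  have hr0 : (0 : ℝ) < r := by exact_mod_cast hr
  set c₀ := Real.exp (-A) with hc₀
  have hc₀pos : 0 < c₀ := Real.exp_pos _
  refine ⟨2 * c₀ * ε ^ 2 * η / r, ((L₀ : ℝ) + 2) ^ (-(r : ℝ)), by positivity, by positivity, ?_⟩
  intro x hx hxx₀
  have hs := f_summable r hr P hPdeg hPlc f hfP hfpos x hx
  have hG : 0 ≤ Gf f x := by
    have := prod_le_Gf f hfpos x hx hs ∅ (by simp)
    simp at this
    linarith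
  refine ⟨hG, ⌈A / x⌉₊ + 1, ?_⟩
  intro k hk α hα N hN θ
  have hk1 : (1 : ℝ) ≤ k := by exact_mod_cast hk
  set X : ℝ := x ^ (-(1 : ℝ) / r) with hX
  have hX0 : 0 < X := by positivity
  have hXr : X ^ r = x⁻¹ := by
    rw [hX, ← Real.rpow_natCast, ← Real.rpow_mul hx.le, div_mul_cancel₀ _ hr0.ne', Real.rpow_neg_one]
  have hXL : (L₀ : ℝ) + 2 ≤ X := by
    have h1 : ((L₀ : ℝ) + 2) ^ r ≤ X ^ r := by
      rw [hXr, le_inv_comm₀ (by positivity) hx]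
      rw [Real.rpow_neg (by positivity), Real.rpow_natCast] at hxx₀
      exact hxx₀.le
    exact le_of_pow_le_pow_left₀ (by omega) hX0.le h1
  set L := ⌊X⌋₊ with hL
  have hLX : (L : ℝ) ≤ X := Nat.floor_le hX0.le
  have hLX2 : X < L + 1 := Nat.lt_floor_add_one X
  have hL0 : L₀ ≤ L := by
    have : (L₀ : ℝ) < L := by linarith
    exact_mod_cast this.le
  have hLhalf : X / 2 ≤ L := by
    have : (0 : ℝ) ≤ L₀ := Nat.cast_nonneg _
    linarith
  set B := (Finset.Icc 1 L).filter fun l : ℕ => ¬ Near (α + f (l : ℤ) * θ) (ε / k) with hB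
  have hBcard : η * L ≤ B.card := by
    refine hdio L hL0 k hk1 α θ hα B ?_
    intro l h1 h2 h3
    by_contra hcon
    exact h3 (by rw [hB, Finset.mem_filter, Finset.mem_Icc]; exact ⟨⟨h1, h2⟩, hcon⟩)
  set T := (Finset.range N).filter fun i => i + 1 ∈ partSet f with hT
  set W := T.filter fun i : ℕ => ¬ Near (α + ((i + 1 : ℕ) : ℝ) * θ) (ε / k) ∧ ((i + 1 : ℕ) : ℝ) ≤ A / x with hW
  have hBW : B.card ≤ r * W.card := by
    apply Finset.card_le_mul_card_image_of_maps_to (f := fun l : ℕ => (f (l : ℤ) - 1).toNat)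
    · intro l hl
      rw [hB, Finset.mem_filter, Finset.mem_Icc] at hl
      obtain ⟨⟨h1, h2⟩, h3⟩ := hl
      have hp := hfpos l (by exact_mod_cast h1)
      have e : (((f (l : ℤ) - 1).toNat + 1 : ℕ) : ℤ) = f l := by
        push_cast; rw [Int.toNat_of_nonneg (by omega)]; ring
      have e' : (((f (l : ℤ) - 1).toNat + 1 : ℕ) : ℝ) = (f (l : ℤ) : ℝ) := by exact_mod_cast congrArg (Int.cast : ℤ → ℝ) e
      have hbd : (((f (l : ℤ) - 1).toNat + 1 : ℕ) : ℝ) ≤ A / x := by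
        rw [e']
        calc (f (l : ℤ) : ℝ) ≤ |(f (l : ℤ) : ℝ)| := le_abs_self _
          _ ≤ A * (l : ℝ) ^ r := hgrow l h1
          _ ≤ A * X ^ r := by
            gcongr
            exact le_trans (by exact_mod_cast h2) hLX
          _ = A / x := by rw [hXr, div_eq_mul_inv]
      have hlt : (f (l : ℤ) - 1).toNat < N := by
        have h4 : (((f (l : ℤ) - 1).toNat + 1 : ℕ) : ℝ) ≤ (⌈A / x⌉₊ : ℝ) := hbd.trans (Nat.le_ceil _)
        have h5 : (f (l : ℤ) - 1).toNat + 1 ≤ ⌈A / x⌉₊ := by exact_mod_cast h4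
        omega
      simp only [hW, hT, Finset.mem_filter, Finset.mem_range]
      refine ⟨⟨hlt, ⟨l, by exact_mod_cast h1, e⟩⟩, ?_, hbd⟩
      rw [e']; exact h3
    · intro b hb
      apply fiber_card r hr P hPdeg f hfP _ (b + 1)
      intro l hl
      rw [Finset.mem_filter, hB, Finset.mem_filter, Finset.mem_Icc] at hl
      have hp := hfpos l (by exact_mod_cast hl.1.1.1)
      omega
  set v : ℝ := 4 * c₀ * (ε / k) ^ 2 with hv
  set ρ := Real.exp (-x) with hρ
  have hρ0 : 0 < ρ := Real.exp_pos _
  have hρ1 : ρ < 1 := by rw [hρ, Real.exp_lt_one_iff]; linarith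
  have hterm : ∀ i ∈ T, ‖1 - Complex.exp (2 * Real.pi * Complex.I * α) *
          ((ρ : ℝ) * Complex.exp (2 * Real.pi * Complex.I * θ)) ^ (i + 1)‖⁻¹ ≤
          (1 - ρ ^ (i + 1))⁻¹ * (if i ∈ W then Real.exp (-v) else 1) := by
    intro i hi
    have e : Complex.exp (2 * Real.pi * Complex.I * α) *
          ((ρ : ℝ) * Complex.exp (2 * Real.pi * Complex.I * θ)) ^ (i + 1) =
        ((ρ ^ (i + 1) : ℝ) : ℂ) * Complex.exp (2 * Real.pi * Complex.I *
          ((α + ((i + 1 : ℕ) : ℝ) * θ : ℝ) : ℂ)) := by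
      rw [mul_pow, ← Complex.exp_nat_mul, mul_left_comm, ← Complex.exp_add]
      push_cast
      congr 2
      ring
    rw [e]
    have hy1 : ρ ^ (i + 1) < 1 := pow_lt_one₀ hρ0.le hρ1 (by omega)
    have hy0 : 0 < ρ ^ (i + 1) := by positivity
    split_ifs with hiW
    · rw [hW, Finset.mem_filter] at hiW
      obtain ⟨_, hnn, hle⟩ := hiW
      have hcy : c₀ ≤ ρ ^ (i + 1) := by
        rw [hρ, ← Real.exp_nat_mul, hc₀, Real.exp_le_exp]
        rw [le_div_iff₀ hx] at hle
        linarith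
      have h1 := term_far (ρ ^ (i + 1)) _ (ε / k) c₀ hy1 hc₀pos hcy (by positivity)
        ((div_le_self hε.le hk1).trans hε1) hnn
      rw [Real.exp_neg, ← mul_inv]
      have : 0 < 1 - ρ ^ (i + 1) := by linarith
      exact inv_anti₀ (by positivity) h1
    · rw [mul_one]
      exact inv_anti₀ (by linarith) (term_ge _ _ hy0.le)
  rw [← Finset.prod_filter]
  calc _ ≤ ∏ i ∈ T, ((1 - ρ ^ (i + 1))⁻¹ * (if i ∈ W then Real.exp (-v) else 1)) :=
        Finset.prod_le_prod (fun _ _ => by positivity) hterm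
    _ = (∏ i ∈ T, (1 - ρ ^ (i + 1))⁻¹) * Real.exp (-v) ^ W.card := by
        rw [Finset.prod_mul_distrib]
        congr 1
        rw [← Finset.prod_filter, Finset.prod_const]
        congr 2
        ext i
        simp only [Finset.mem_filter, and_iff_right_iff_imp]
        intro h
        rw [hW] at h
        exact (Finset.mem_filter.1 h).1
    _ ≤ Gf f x * Real.exp (-v) ^ W.card := by
        gcongr
        have := prod_le_Gf f hfpos x hx hs (T.map (addRightEmbedding 1)) (by
          intro s hs'
          obtain ⟨i, hi, rfl⟩ := Finset.mem_map.1 hs'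
          exact (Finset.mem_filter.1 hi).2)
        rw [Finset.prod_map] at this
        exact this
    _ ≤ _ := by
        gcongr
        rw [← Real.exp_nat_mul, Real.exp_le_exp]
        have h1 : (B.card : ℝ) ≤ r * W.card := by exact_mod_cast hBW
        have h2 : η * (X / 2) ≤ r * W.card := (by gcongr : η * (X / 2) ≤ η * L).trans (hBcard.trans h1)
        have h3 : η * (X / 2) / r ≤ W.card := by rw [div_le_iff₀ hr0]; linarith
        have h4 : 2 * c₀ * ε ^ 2 * η / r / (k : ℝ) ^ 2 * X = v * (η * (X / 2) / r) := by
          rw [hv]; field_simp; ring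
        rw [h4]
        have h5 : v * (η * (X / 2) / r) ≤ v * W.card := by gcongr
        linarith


open scoped Classical in
lemma pf_eq (f : ℤ → ℤ) (n : ℕ) :
    pf f n = ((Finset.univ : Finset n.Partition).filter fun π => PartsIn f π).card := by
  rw [pf, Nat.card_eq_fintype_card, Fintype.card_subtype]

open scoped Classical in
lemma pfa_eq (f : ℤ → ℤ) (a K n : ℕ) :
    pfa f a K n = ∑ π ∈ (Finset.univ : Finset n.Partition).filter fun π => PartsIn f π,
      if Multiset.card π.parts % K = a % K then 1 else 0 := by
  have h1 : ∀ m, pfm f m n = ∑ π ∈ (Finset.univ : Finset n.Partition).filter fun π => PartsIn f π,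
      if Multiset.card π.parts = m then 1 else 0 := by
    intro m
    rw [pfm, Nat.card_eq_fintype_card, Fintype.card_subtype, ← Finset.filter_filter,
      Finset.card_filter]
  rw [pfa]
  simp only [h1]
  have h2 : ∀ m, (if m % K = a % K then
      ∑ π ∈ (Finset.univ : Finset n.Partition).filter fun π => PartsIn f π,
        (if Multiset.card π.parts = m then 1 else 0) else 0) =
      ∑ π ∈ (Finset.univ : Finset n.Partition).filter fun π => PartsIn f π,
        (if Multiset.card π.parts = m then (if m % K = a % K then 1 else 0) else 0) := by
    intro m
    split_ifs <;> simp
  simp only [h2]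
  rw [Finset.sum_comm]
  refine Finset.sum_congr rfl fun π _ => ?_
  rw [Finset.sum_ite_eq, if_pos]
  rw [Finset.mem_range]
  have : Multiset.card π.parts ≤ π.parts.sum := by
    have := Multiset.card_nsmul_le_sum (s := π.parts) (a := 1) (fun x hx => π.parts_pos hx)
    simpa using this
  rw [π.parts_sum] at this
  omega

lemma parts_mod (f : ℤ → ℤ) (δ : ℕ) (hδ : ∀ ℓ : ℤ, (δ : ℤ) ∣ f ℓ - f 0) (s : Multiset ℕ)
    (hs : ∀ i ∈ s, ∃ ℓ : ℤ, 1 ≤ ℓ ∧ (i : ℤ) = f ℓ) :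
    (δ : ℤ) ∣ (s.sum : ℤ) - (Multiset.card s : ℤ) * f 0 := by
  induction s using Multiset.induction_on with
  | empty => simp
  | cons a s ih =>
    have h1 := ih fun i hi => hs i (by simp [hi])
    obtain ⟨l, _, hl⟩ := hs a (by simp)
    have h2 := hδ l
    rw [← hl] at h2
    have := dvd_add h1 h2
    have e : ((a ::ₘ s).sum : ℤ) - (Multiset.card (a ::ₘ s) : ℤ) * f 0 =
        ((s.sum : ℤ) - (Multiset.card s : ℤ) * f 0) + ((a : ℤ) - f 0) := by
      rw [Multiset.sum_cons, Multiset.card_cons]; push_cast; ring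
    rw [e]; exact this

lemma coprime_f0 (f : ℤ → ℤ) (hfprime : ∀ p : ℕ, p.Prime → ∃ ℓ : ℤ, ¬ ((p : ℤ) ∣ f ℓ))
    (δ : ℕ) (hδ : ∀ ℓ : ℤ, (δ : ℤ) ∣ f ℓ - f 0) : IsCoprime (δ : ℤ) (f 0) := by
  rw [Int.isCoprime_iff_gcd_eq_one]
  by_contra hne
  obtain ⟨p, hp, hpd⟩ := Nat.exists_prime_and_dvd hne
  obtain ⟨l, hl⟩ := hfprime p hp
  have h0 : (p : ℤ) ∣ ((Int.gcd δ (f 0) : ℕ) : ℤ) := by exact_mod_cast hpd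
  have h1 : (p : ℤ) ∣ δ := h0.trans (Int.gcd_dvd_left _ _)
  have h2 : (p : ℤ) ∣ f 0 := h0.trans (Int.gcd_dvd_right _ _)
  apply hl
  have := dvd_add (h1.trans (hδ l)) h2
  simpa using this

/-- `e(t) = exp(2 π i t)`. -/
noncomputable def ee (t : ℝ) : ℂ := Complex.exp (2 * Real.pi * Complex.I * t)

lemma ee_norm (t : ℝ) : ‖ee t‖ = 1 := by
  rw [ee, Complex.norm_exp]; simp

lemma ee_pow (t : ℝ) (m : ℕ) : ee t ^ m = ee (m * t) := by
  rw [ee, ee, ← Complex.exp_nat_mul]; congr 1; push_cast; ring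

lemma ee_add (s t : ℝ) : ee (s + t) = ee s * ee t := by
  rw [ee, ee, ee, ← Complex.exp_add]; congr 1; push_cast; ring

lemma ee_eq_one (t : ℝ) : ee t = 1 ↔ ∃ n : ℤ, t = n := by
  rw [ee, Complex.exp_eq_one_iff]
  refine exists_congr fun n => ?_
  have h : (2 * Real.pi * Complex.I : ℂ) ≠ 0 := Complex.two_pi_I_ne_zero
  rw [mul_comm (n : ℂ), mul_right_inj' h]
  exact_mod_cast Iff.rfl

lemma sum_ee (K : ℕ) (hK : 0 < K) (b : ℤ) :
    ∑ j ∈ Finset.range K, ee (j * ((b : ℝ) / K)) = if (K : ℤ) ∣ b then (K : ℂ) else 0 := by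
  have hK0 : (K : ℝ) ≠ 0 := by positivity
  simp only [← ee_pow]
  split_ifs with h
  · obtain ⟨c, rfl⟩ := h
    have : ee ((((K : ℤ) * c : ℤ) : ℝ) / K) = 1 := by
      rw [ee_eq_one]; exact ⟨c, by push_cast; field_simp⟩
    simp only [this, one_pow]; simp
  · have hne : ee ((b : ℝ) / K) ≠ 1 := by
      rw [Ne, ee_eq_one]
      rintro ⟨c, hc⟩
      apply h
      rw [div_eq_iff hK0] at hc
      exact ⟨c, by rw [mul_comm]; exact_mod_cast hc⟩
    rw [geom_sum_eq hne, ee_pow]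
    have : ee (K * ((b : ℝ) / K)) = 1 := by
      rw [ee_eq_one]; exact ⟨b, by field_simp⟩
    rw [this]; simp

lemma card_mult (δ k : ℕ) (hk : 0 < k) :
    ((Finset.range (δ * k)).filter fun j => k ∣ j).card = δ := by
  have : (Finset.range (δ * k)).filter (fun j => k ∣ j) = (Finset.range δ).image fun i => i * k := by
    ext j
    simp only [Finset.mem_filter, Finset.mem_range, Finset.mem_image]
    constructor
    · rintro ⟨h1, ⟨i, rfl⟩⟩
      exact ⟨i, by rw [mul_comm δ] at h1; exact lt_of_mul_lt_mul_left h1 (Nat.zero_le _), mul_comm _ _⟩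
    · rintro ⟨i, hi, rfl⟩
      exact ⟨Nat.mul_lt_mul_of_pos_right hi hk, dvd_mul_left _ _⟩
  rw [this, Finset.card_image_of_injective, Finset.card_range]
  intro a b hab
  exact Nat.eq_of_mul_eq_mul_right hk hab

lemma detect (δ k : ℕ) (hδ : 0 < δ) (hk : 0 < k) (b : ℤ) (hb : (δ : ℤ) ∣ b) :
    ∑ j ∈ (Finset.range (δ * k)).filter (fun j => ¬ k ∣ j), ee (j * ((b : ℝ) / (δ * k : ℕ))) =
      (if ((δ * k : ℕ) : ℤ) ∣ b then ((δ * k : ℕ) : ℂ) else 0) - δ := by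
  rw [← sum_ee (δ * k) (by positivity) b,
    ← Finset.sum_filter_add_sum_filter_not (Finset.range (δ * k)) (fun j => k ∣ j)]
  have : ∑ j ∈ (Finset.range (δ * k)).filter (fun j => k ∣ j), ee (j * ((b : ℝ) / (δ * k : ℕ))) = δ := by
    rw [Finset.sum_congr rfl (g := fun _ => (1 : ℂ))]
    · rw [Finset.sum_const, card_mult δ k hk]; simp
    · intro j hj
      obtain ⟨i, rfl⟩ := (Finset.mem_filter.1 hj).2
      obtain ⟨c, rfl⟩ := hb
      rw [ee_eq_one]
      refine ⟨i * c, ?_⟩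
      have h1 : (δ : ℝ) ≠ 0 := by positivity
      have h2 : (k : ℝ) ≠ 0 := by positivity
      push_cast
      field_simp
  rw [this]; ring

lemma key_identity (f : ℤ → ℤ)
    (hfprime : ∀ p : ℕ, p.Prime → ∃ ℓ : ℤ, ¬ ((p : ℤ) ∣ f ℓ))
    (δ a k n : ℕ) (hδ : 0 < δ) (hk : 0 < k) (hdvd : ∀ ℓ : ℤ, (δ : ℤ) ∣ f ℓ - f 0)
    (hn : (δ : ℤ) ∣ (n : ℤ) - (a : ℤ) * f 0) :
    ((δ * k : ℕ) : ℂ) * ((pfa f a (δ * k) n : ℂ) - (pf f n : ℂ) / k) =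
      ∑ j ∈ (Finset.range (δ * k)).filter (fun j => ¬ k ∣ j),
        ee (-(j * ((a : ℝ) / (δ * k : ℕ)))) * Az (partSet f) (ee (j / (δ * k : ℕ))) n := by
  classical
  have hkC : (k : ℂ) ≠ 0 := by exact_mod_cast hk.ne'
  set U := (Finset.univ : Finset n.Partition).filter fun π => PartsIn f π with hU
  have hA : ∀ ζ : ℂ, Az (partSet f) ζ n = ∑ π ∈ U, ζ ^ (Multiset.card π.parts) := by
    intro ζ
    rw [hU, Finset.sum_filter, Az]
    refine Finset.sum_congr rfl fun π _ => ?_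
    congr 1
  have hm : ∀ π ∈ U, (δ : ℤ) ∣ (Multiset.card π.parts : ℤ) - a := by
    intro π hπ
    have h1 := parts_mod f δ hdvd π.parts (Finset.mem_filter.1 hπ).2
    rw [π.parts_sum] at h1
    have h2 := dvd_sub hn h1
    have h3 : (δ : ℤ) ∣ f 0 * ((Multiset.card π.parts : ℤ) - a) := by
      have e : f 0 * ((Multiset.card π.parts : ℤ) - a) =
        ((n : ℤ) - (a : ℤ) * f 0) - ((n : ℤ) - (Multiset.card π.parts : ℤ) * f 0) := by ring
      rw [e]; exact h2
    exact (coprime_f0 f hfprime δ hdvd).dvd_of_dvd_mul_left h3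
  simp only [hA, Finset.mul_sum]
  rw [Finset.sum_comm]
  have hterm : ∀ π ∈ U, ∑ j ∈ (Finset.range (δ * k)).filter (fun j => ¬ k ∣ j),
      ee (-(j * ((a : ℝ) / (δ * k : ℕ)))) * ee (j / (δ * k : ℕ)) ^ (Multiset.card π.parts) =
      ((δ * k : ℕ) : ℂ) * (if Multiset.card π.parts % (δ * k) = a % (δ * k) then 1 else 0) - δ := by
    intro π hπ
    have h1 := detect δ k hδ hk _ (hm π hπ)
    have h2 : (((δ * k : ℕ) : ℤ) ∣ (Multiset.card π.parts : ℤ) - a) ↔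
        Multiset.card π.parts % (δ * k) = a % (δ * k) := by
      rw [← Nat.modEq_iff_dvd]
      exact ⟨fun h => h.symm, fun h => Eq.symm h⟩
    rw [if_congr h2 rfl rfl] at h1
    rw [mul_ite, mul_one, mul_zero, ← h1]
    refine Finset.sum_congr rfl fun j _ => ?_
    rw [ee_pow, ← ee_add]
    congr 1
    push_cast
    ring
  rw [Finset.sum_congr rfl hterm, Finset.sum_sub_distrib, ← Finset.mul_sum, pfa_eq, pf_eq, ← hU]
  rw [Finset.sum_const, mul_sub]
  congr 1
  · push_cast; rfl
  · push_cast; field_simp; simp [mul_comm]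

lemma far_alpha (Pif δ k j : ℕ) (hδ : 0 < δ) (hdvd : δ ∣ Pif) (hk : 0 < k) (hPifpos : 0 < Pif)
    (hp : ∀ p : ℕ, p.Prime → p ∣ k → ¬ (p * δ ∣ Pif)) (hj : ¬ k ∣ j) :
    ¬ Near (Pif * ((j : ℝ) / (δ * k : ℕ))) (1 / (2 * k)) := by
  rintro ⟨n, hn⟩
  obtain ⟨c, rfl⟩ := hdvd
  have hcop : Nat.Coprime k c := by
    apply Nat.Coprime.symm
    apply Nat.coprime_of_dvd
    intro p hpp hpc hpk
    obtain ⟨d, rfl⟩ := hpc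
    exact hp p hpp hpk ⟨d, by ring⟩
  have hδ' : (0 : ℝ) < δ := by exact_mod_cast hδ
  have hk' : (0 : ℝ) < k := by exact_mod_cast hk
  have e : ((δ * c : ℕ) : ℝ) * ((j : ℝ) / (δ * k : ℕ)) - n = ((c : ℝ) * j - n * k) / k := by
    push_cast; field_simp
  rw [e, abs_div, abs_of_pos hk', div_le_div_iff₀ hk' (by positivity)] at hn
  have h1 : |(c : ℝ) * j - n * k| < 1 := by nlinarith
  have h2 : |(c : ℤ) * j - n * k| < 1 := by exact_mod_cast h1
  have h3 := Int.abs_lt_one_iff.1 h2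
  have h4 : (k : ℤ) ∣ ((c * j : ℕ) : ℤ) := ⟨n, by push_cast; linarith⟩
  have h5 : k ∣ c * j := by exact_mod_cast h4
  exact hj (hcop.dvd_of_dvd_mul_left h5)

theorem stmt6 (r : ℕ) (hr : 1 ≤ r) (P : Polynomial ℚ) (hPdeg : P.natDegree = r)
    (hPlc : 0 < P.leadingCoeff)
    (f : ℤ → ℤ) (hfP : ∀ ℓ : ℤ, (f ℓ : ℚ) = P.eval (ℓ : ℚ))
    (hfpos : ∀ ℓ : ℤ, 1 ≤ ℓ → 0 < f ℓ)
    (hfprime : ∀ p : ℕ, p.Prime → ∃ ℓ : ℤ, ¬ ((p : ℤ) ∣ f ℓ))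
    (Pif : ℕ) (hPifpos : 0 < Pif)
    (hPif : ∀ d : ℕ, d ∣ Pif ↔ ∀ ℓ : ℤ, (d : ℤ) ∣ (f ℓ - f 0)) :
    ∃ δf' C x₀ : ℝ, 0 < δf' ∧ 0 < C ∧ 0 < x₀ ∧
      ∀ x : ℝ, 0 < x → x < x₀ →
        ∀ δ a k : ℕ, 0 < δ → δ ∣ Pif → 0 < a → 0 < k →
          (∀ p : ℕ, p.Prime → p ∣ k → ¬ (p * δ ∣ Pif)) →
          ((k : ℝ) ≤ x ^ (-(1 : ℝ) / (2 * r))) →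
          (∑' n : ℕ, if (δ : ℤ) ∣ ((n : ℤ) - (a : ℤ) * f 0) then
              |(pfa f a (δ * k) n : ℝ) - (pf f n : ℝ) / k| ^ 2 * Real.exp (-2 * n * x)
            else 0) ≤
            C * Gf f x ^ 2 * Real.exp (-2 * δf' / (k : ℝ) ^ 2 * x ^ (-(1 : ℝ) / r)) := by
  classical
  obtain ⟨c, x₀, hc, hx₀, hsup⟩ := sup_bound r hr P hPdeg hPlc f hfP hfpos Pif hPif
  refine ⟨c, 1, x₀, hc, one_pos, hx₀, ?_⟩
  intro x hx hxx₀ δ a k hδ hδP _ hk hp _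
  obtain ⟨hG, N₀, hN₀⟩ := hsup x hx hxx₀
  set M : ℝ := Gf f x * Real.exp (-(c / (k : ℝ) ^ 2 * x ^ (-(1 : ℝ) / r))) with hM
  have hM0 : 0 ≤ M := by positivity
  have hRHS : 1 * Gf f x ^ 2 * Real.exp (-2 * c / (k : ℝ) ^ 2 * x ^ (-(1 : ℝ) / r)) = M ^ 2 := by
    rw [hM, mul_pow, ← Real.exp_nat_mul, one_mul]
    congr 2
    push_cast
    ring
  rw [hRHS]
  have hdvd : ∀ ℓ : ℤ, (δ : ℤ) ∣ f ℓ - f 0 := (hPif δ).1 hδP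
  set K := δ * k with hK
  have hK0 : 0 < K := by positivity
  have hKR : (0 : ℝ) < K := by exact_mod_cast hK0
  set J := (Finset.range K).filter (fun j => ¬ k ∣ j) with hJ
  have hJcard : (J.card : ℝ) ≤ K := by
    have : J.card ≤ K := (Finset.card_filter_le _ _).trans (by simp)
    exact_mod_cast this
  set ρ := Real.exp (-x) with hρ
  have hρ0 : 0 < ρ := Real.exp_pos _
  have hρ1 : ρ < 1 := by rw [hρ, Real.exp_lt_one_iff]; linarith
  have hexp : ∀ n : ℕ, Real.exp (-2 * n * x) = ρ ^ (2 * n) := by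
    intro n
    rw [hρ, ← Real.exp_nat_mul]; congr 1; push_cast; ring
  have hJsum : ∀ j ∈ J, ∀ N, N₀ ≤ N →
      ∑ n ∈ Finset.range (N + 1), ‖Az (partSet f) (ee (j / K)) n‖ ^ 2 * ρ ^ (2 * n) ≤ M ^ 2 := by
    intro j hj N hN
    refine sum_Az_le (partSet f) _ (ee_norm _) ρ hρ0 hρ1 N M hM0 fun θ => ?_
    exact hN₀ k hk _ (far_alpha Pif δ k j hδ hδP hk hPifpos hp (Finset.mem_filter.1 hj).2) N hN θ
  set t : ℕ → ℝ := fun n => if (δ : ℤ) ∣ ((n : ℤ) - (a : ℤ) * f 0) then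
      |(pfa f a K n : ℝ) - (pf f n : ℝ) / k| ^ 2 * Real.exp (-2 * n * x) else 0 with ht
  have ht0 : ∀ n, 0 ≤ t n := by
    intro n; simp only [ht]; split_ifs <;> positivity
  have htle : ∀ n, t n ≤ (1 / K) * ∑ j ∈ J, ‖Az (partSet f) (ee (j / K)) n‖ ^ 2 * ρ ^ (2 * n) := by
    intro n
    simp only [ht]
    split_ifs with hn
    · have hid := key_identity f hfprime δ a k n hδ hk hdvd hn
      rw [← hK, ← hJ] at hid
      set D : ℝ := (pfa f a K n : ℝ) - (pf f n : ℝ) / k with hD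
      have h1 : (K : ℝ) * |D| ≤ ∑ j ∈ J, ‖Az (partSet f) (ee (j / K)) n‖ := by
        have h2 := congrArg norm hid
        have h3 : ‖(K : ℂ) * ((pfa f a K n : ℂ) - (pf f n : ℂ) / k)‖ = K * |D| := by
          have : (K : ℂ) * ((pfa f a K n : ℂ) - (pf f n : ℂ) / k) = ((K * D : ℝ) : ℂ) := by
            rw [hD]; push_cast; rfl
          rw [this, Complex.norm_real, Real.norm_eq_abs, abs_mul, abs_of_pos hKR]
        rw [h3] at h2
        rw [h2]
        refine (norm_sum_le _ _).trans (le_of_eq (Finset.sum_congr rfl fun j _ => ?_))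
        rw [norm_mul, ee_norm, one_mul]
      have h4 : ((K : ℝ) * |D|) ^ 2 ≤ K * ∑ j ∈ J, ‖Az (partSet f) (ee (j / K)) n‖ ^ 2 := by
        calc ((K : ℝ) * |D|) ^ 2 ≤ (∑ j ∈ J, ‖Az (partSet f) (ee (j / K)) n‖) ^ 2 := by gcongr
          _ ≤ J.card * ∑ j ∈ J, ‖Az (partSet f) (ee (j / K)) n‖ ^ 2 := sq_sum_le_card_mul_sum_sq
          _ ≤ _ := by gcongr
      have h5 : |D| ^ 2 ≤ (1 / K) * ∑ j ∈ J, ‖Az (partSet f) (ee (j / K)) n‖ ^ 2 := by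
        rw [one_div, inv_mul_eq_div, le_div_iff₀ hKR]
        rw [mul_pow] at h4
        nlinarith
      rw [hexp, ← Finset.sum_mul, ← mul_assoc]
      gcongr
    · positivity
  refine Real.tsum_le_of_sum_range_le ht0 fun N' => ?_
  set N := max N' N₀ with hN
  calc ∑ n ∈ Finset.range N', t n ≤ ∑ n ∈ Finset.range (N + 1), t n := by
        apply Finset.sum_le_sum_of_subset_of_nonneg
        · intro i hi
          rw [Finset.mem_range] at hi ⊢
          have := le_max_left N' N₀
          omega
        · exact fun n _ _ => ht0 n
    _ ≤ ∑ n ∈ Finset.range (N + 1),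
        (1 / K) * ∑ j ∈ J, ‖Az (partSet f) (ee (j / K)) n‖ ^ 2 * ρ ^ (2 * n) :=
        Finset.sum_le_sum fun n _ => htle n
    _ = (1 / K) * ∑ j ∈ J, ∑ n ∈ Finset.range (N + 1),
        ‖Az (partSet f) (ee (j / K)) n‖ ^ 2 * ρ ^ (2 * n) := by
        rw [← Finset.mul_sum, Finset.sum_comm]
    _ ≤ (1 / K) * ∑ j ∈ J, M ^ 2 := by
        gcongr with j hj
        exact hJsum j hj N (le_max_right _ _)
    _ = (1 / K) * (J.card * M ^ 2) := by rw [Finset.sum_const, nsmul_eq_mul]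
    _ ≤ (1 / K) * (K * M ^ 2) := by gcongr
    _ = M ^ 2 := by field_simp
end

section
/- There exist constants c > 0 and M > 0 depending only on f with the following property: for every positive divisor δ of Π_f, all positive integers k, j, L with 1 ≤ j < k such that pδ ∤ Π_f for every prime p dividing k, every integer ℓ, and every real number y, if k^{−2}·L ≥ M then Re Σ_{n=1}^{L} [1 − e((kℓ + j)/(δk) − f(n)·y)] ≥ c·k^{−2}·L, where e(t) := e^{2πit}. -/
def NearInt (x e : ℝ) : Prop := ∃ m : ℤ, |x - m| ≤ e

lemma NearInt.sub {x y e : ℝ} (hx : NearInt x e) (hy : NearInt y e) : NearInt (x - y) (2 * e) := by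
  obtain ⟨m, hm⟩ := hx
  obtain ⟨n, hn⟩ := hy
  refine ⟨m - n, ?_⟩
  rw [abs_le] at *
  push_cast
  constructor <;> linarith [hm.1, hm.2, hn.1, hn.2]

lemma nearInt_of_mult (x e : ℝ) (he : e < 1 / 3) (K : ℕ) (hK : 1 ≤ K)
    (h : ∀ d : ℕ, 1 ≤ d → d ≤ K → NearInt (x * d) e) : NearInt x (e / K) := by
  obtain ⟨m, hm⟩ := h 1 le_rfl hK
  rw [Nat.cast_one, mul_one] at hm
  have key : ∀ d : ℕ, 1 ≤ d → d ≤ K → |(x - m) * d| ≤ e := by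
    intro d hd
    induction d, hd using Nat.le_induction with
    | base => intro _; simpa using hm
    | succ d hd ih =>
      intro hdK
      have h1 := ih (by omega)
      obtain ⟨m', hm'⟩ := h (d + 1) (by omega) hdK
      have h0 : m' - (d + 1) * m = 0 := by
        rw [← Int.abs_lt_one_iff]
        have : |((m' - (d + 1) * m : ℤ) : ℝ)| < 1 := by
          push_cast
          push_cast at hm'
          rw [abs_le] at *
          rw [abs_lt]
          constructor <;> nlinarith [hm.1, hm.2, h1.1, h1.2, hm'.1, hm'.2]
        exact_mod_cast this
      have h2 : (m' : ℝ) = (d + 1) * m := by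
        have : m' = (d + 1) * m := by omega
        rw [this]; push_cast; ring
      rw [h2] at hm'
      convert hm' using 2
      push_cast
      ring
  refine ⟨m, ?_⟩
  have h1 := key K hK le_rfl
  have hK' : (0 : ℝ) < K := by exact_mod_cast hK
  rw [abs_mul, abs_of_pos hK'] at h1
  rwa [le_div_iff₀ hK']

open Polynomial in
lemma diff_poly (r : ℕ) (g : ℝ[X]) (hg : g.natDegree ≤ r + 1) (d : ℝ) :
    (taylor d g - g).natDegree ≤ r ∧
      (taylor d g - g).coeff r = (r + 1) * g.coeff (r + 1) * d := by
  have hz : ∀ i, r + 1 < i → g.coeff i = 0 := fun i hi =>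
    coeff_eq_zero_of_natDegree_lt (lt_of_le_of_lt hg hi)
  constructor
  · rw [natDegree_le_iff_coeff_eq_zero]
    intro i hi
    rw [coeff_sub, taylor_coeff]
    have : hasseDeriv i g = C (g.coeff i) := by
      ext n
      rw [hasseDeriv_coeff, coeff_C]
      split_ifs with h
      · subst h; simp
      · rw [hz _ (by omega)]; simp
    rw [this]; simp
  · rw [coeff_sub, taylor_coeff]
    have : hasseDeriv r g = C (g.coeff r) + C ((r + 1) * g.coeff (r + 1)) * X := by
      ext n
      rw [hasseDeriv_coeff, coeff_add, coeff_C, coeff_C_mul, coeff_X]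
      rcases n with _ | _ | n
      · simp
      · simp [add_comm 1 r]
      · rw [hz _ (by omega)]; simp
    rw [this]; simp

open Polynomial in
open Classical in
lemma weyl (r : ℕ) : ∀ (g : ℝ[X]) (_ : g.natDegree ≤ r) (N b K : ℕ) (e : ℝ) (_ : 0 ≤ e)
    (_ : 2 ^ r * e < 1 / 3) (_ : 1 ≤ K) (_ : 2 ^ r * b + r * K < N)
    (_ : ((Finset.Icc 1 N).filter (fun n : ℕ => ¬ NearInt (g.eval (n : ℝ)) e)).card ≤ b),
    NearInt (r.factorial * g.coeff r) (2 ^ r * e / K ^ r) := by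
  induction r with
  | zero =>
    intro g hg N b K e he0 he hK hN hb
    have hg' : g = C (g.coeff 0) := eq_C_of_natDegree_le_zero hg
    by_contra hcon
    have : (Finset.Icc 1 N).filter (fun n : ℕ => ¬ NearInt (g.eval (n : ℝ)) e) = Finset.Icc 1 N := by
      apply Finset.filter_true_of_mem
      intro n _
      rw [hg', eval_C]
      simpa using hcon
    rw [this] at hb
    simp at hb hN
    omega
  | succ r ih =>
    intro g hg N b K e he0 he hK hN hb
    have hK1 : (1 : ℝ) ≤ K := by exact_mod_cast hK
    have hKr : (1 : ℝ) ≤ K ^ r := one_le_pow₀ hK1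
    have key : NearInt ((r + 1).factorial * g.coeff (r + 1)) (2 ^ r * (2 * e) / K ^ r / K) := by
      apply nearInt_of_mult _ _ _ K hK
      · intro d hd hdK
        obtain ⟨h1, h2⟩ := diff_poly r g hg d
        have := ih (taylor (d : ℝ) g - g) h1 (N - d) (2 * b) K (2 * e) (by linarith)
          (by rw [pow_succ] at he; linarith) hK ?_ ?_
        · rw [h2] at this
          convert this using 1
          rw [Nat.factorial_succ]; push_cast; ring
        · have e1 : 2 ^ r * (2 * b) = 2 ^ (r + 1) * b := by ring
          have e2 : (r + 1) * K = r * K + K := by ring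
          omega
        · set S := (Finset.Icc 1 N).filter (fun n : ℕ => ¬ NearInt (g.eval (n : ℝ)) e)
          have hsub : (Finset.Icc 1 (N - d)).filter
              (fun n : ℕ => ¬ NearInt ((taylor (d : ℝ) g - g).eval (n : ℝ)) (2 * e)) ⊆
              S ∪ S.image (fun n => n - d) := by
            intro n hn
            simp only [Finset.mem_filter, Finset.mem_Icc] at hn
            by_contra hcon
            rw [Finset.mem_union, not_or] at hcon
            obtain ⟨c1, c2⟩ := hcon
            apply hn.2
            rw [eval_sub, taylor_eval]
            apply NearInt.sub
            · by_contra h3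
              apply c2
              rw [Finset.mem_image]
              refine ⟨n + d, ?_, by omega⟩
              rw [Finset.mem_filter, Finset.mem_Icc]
              refine ⟨by omega, ?_⟩
              push_cast
              simpa [add_comm] using h3
            · by_contra h3
              apply c1
              rw [Finset.mem_filter, Finset.mem_Icc]
              exact ⟨by omega, h3⟩
          have h4 := Finset.card_le_card hsub
          have h5 := Finset.card_union_le S (S.image (fun n => n - d))
          have h6 : (S.image (fun n => n - d)).card ≤ S.card := Finset.card_image_le
          omega
      · calc 2 ^ r * (2 * e) / (K : ℝ) ^ r ≤ 2 ^ r * (2 * e) := div_le_self (by positivity) hKr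
          _ < 1 / 3 := by rw [pow_succ] at he; linarith
    convert key using 1
    rw [div_div]; ring

lemma one_sub_cos_ge (t e : ℝ) (he : 0 ≤ e) (h : ¬ NearInt t e) :
    8 * e ^ 2 ≤ 1 - Real.cos (2 * Real.pi * t) := by
  have h1 : e < |t - round t| := by
    by_contra hc
    exact h ⟨round t, not_lt.mp hc⟩
  have h2 := abs_sub_round t
  set u := t - round t with hu
  have h3 : Real.cos (2 * Real.pi * t) = Real.cos (2 * Real.pi * u) := by
    rw [← Real.cos_sub_int_mul_two_pi _ (round t)]
    congr 1; rw [hu]; ring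
  rw [h3]
  have hpi := Real.pi_pos
  have h4 := Real.cos_le_one_sub_mul_cos_sq (x := 2 * Real.pi * u) (by
    rw [abs_mul, abs_of_pos (by positivity)]; nlinarith)
  have h5 : 2 / Real.pi ^ 2 * (2 * Real.pi * u) ^ 2 = 8 * u ^ 2 := by
    field_simp; ring
  have h6 : e ^ 2 ≤ u ^ 2 := by
    rw [← sq_abs u]; exact pow_le_pow_left₀ he h1.le 2
  linarith

lemma int_eq_zero_of_abs (m : ℤ) (h : |(m : ℝ)| < 1) : m = 0 := by
  rw [← Int.abs_lt_one_iff]; exact_mod_cast h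

/-- if `x` over `A` is within less than `1/A` of an integer then `A ∣ x` -/
lemma dvd_of_near (A : ℕ) (hA : 0 < A) (x : ℤ) (e : ℝ) (he : A * e < 1)
    (h : NearInt ((x : ℝ) / A) e) : (A : ℤ) ∣ x := by
  obtain ⟨m, hm⟩ := h
  have hA' : (0 : ℝ) < A := by exact_mod_cast hA
  have : x - A * m = 0 := by
    apply int_eq_zero_of_abs
    have : ((x - A * m : ℤ) : ℝ) = A * ((x : ℝ) / A - m) := by
      push_cast; field_simp
    rw [this, abs_mul, abs_of_pos hA']
    exact lt_of_le_of_lt (by gcongr) he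
  exact ⟨m, by omega⟩

lemma exists_period (P : Polynomial ℚ) (f : ℤ → ℤ)
    (hfP : ∀ ℓ : ℤ, (f ℓ : ℚ) = P.eval (ℓ : ℚ)) (A : ℕ) (hA : 0 < A) :
    ∃ T : ℕ, 0 < T ∧ ∀ a b : ℤ, (T : ℤ) ∣ a - b → (A : ℤ) ∣ f a - f b := by
  obtain ⟨D, hD, hD2⟩ := IsLocalization.integerNormalization_spec (nonZeroDivisors ℤ) P
  set Q := IsLocalization.integerNormalization (nonZeroDivisors ℤ) P with hQ
  have hD0 : D ≠ 0 := nonZeroDivisors.ne_zero hD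
  have hmap : Q.map (algebraMap ℤ ℚ) = D • P := by
    exact hD2
  have hev : ∀ a : ℤ, Q.eval a = D * f a := by
    intro a
    have h1 : (Q.map (algebraMap ℤ ℚ)).eval ((algebraMap ℤ ℚ) a) = algebraMap ℤ ℚ (Q.eval a) :=
      Polynomial.eval_map_apply _ _
    rw [hmap] at h1
    have h2 : ((Q.eval a : ℤ) : ℚ) = ((D * f a : ℤ) : ℚ) := by
      rw [Int.cast_mul, hfP]
      simpa using h1.symm
    exact_mod_cast h2
  refine ⟨A * D.natAbs, by positivity, ?_⟩
  intro a b hab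
  have h1 := hab.trans (Polynomial.sub_dvd_eval_sub a b Q)
  rw [hev, hev] at h1
  have h2 : (D * A : ℤ) ∣ D * (f a - f b) := by
    rw [← Int.natAbs_dvd] at h1 ⊢
    simp only [Int.natAbs_mul, Int.natAbs_natCast, Nat.cast_mul] at h1 ⊢
    rw [mul_comm, mul_sub]; exact h1
  exact Int.dvd_of_mul_dvd_mul_left hD0 h2

/-- growth bound -/
lemma growth (r : ℕ) (g : Polynomial ℝ) (hg : g.natDegree ≤ r) :
    ∃ F : ℝ, 0 ≤ F ∧ ∀ n L : ℕ, 1 ≤ n → n ≤ L → |g.eval (n : ℝ)| ≤ F * (L : ℝ) ^ r := by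
  refine ⟨∑ i ∈ Finset.range (r + 1), |g.coeff i|, Finset.sum_nonneg fun _ _ => abs_nonneg _, ?_⟩
  intro n L hn hnL
  rw [Polynomial.eval_eq_sum_range' (Nat.lt_succ_of_le hg), Finset.sum_mul]
  refine (Finset.abs_sum_le_sum_abs _ _).trans (Finset.sum_le_sum ?_)
  intro i hi
  have hL : (1 : ℝ) ≤ L := by exact_mod_cast hn.trans hnL
  have hn' : (n : ℝ) ≤ L := by exact_mod_cast hnL
  rw [abs_mul, abs_pow, Nat.abs_cast]
  gcongr
  exact (pow_le_pow_left₀ (by positivity) hn' i).trans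
    (pow_le_pow_right₀ hL (by simp at hi; omega))

open Classical in
/-- a set of bad points which is small misses a point in every residue class -/
lemma exists_good (T L : ℕ) (hT : 0 < T) (S : Finset ℕ) (hS : T * S.card + T ≤ L) (a : ℤ) :
    ∃ n : ℕ, 1 ≤ n ∧ n ≤ L ∧ n ∉ S ∧ (T : ℤ) ∣ n - a := by
  set a0 : ℕ := ((a - 1) % T).toNat with ha0
  have hT' : (0 : ℤ) < T := by exact_mod_cast hT
  have h1 := Int.emod_nonneg (a - 1) hT'.ne'
  have h2 := Int.emod_lt_of_pos (a - 1) hT'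
  have h3 : (a0 : ℤ) = (a - 1) % T := by omega
  have h4 := Int.emod_add_mul_ediv (a - 1) T
  set φ : ℕ → ℕ := fun i => 1 + a0 + T * i
  have hinj : Function.Injective φ := by
    intro i j hij
    have : T * i = T * j := by simp only [φ] at hij; omega
    exact Nat.eq_of_mul_eq_mul_left hT this
  have : ¬ ((Finset.range (S.card + 1)).image φ ⊆ S) := by
    intro hsub
    have := Finset.card_le_card hsub
    rw [Finset.card_image_of_injective _ hinj] at this
    simp at this
  rw [Finset.not_subset] at this
  obtain ⟨n, hn, hnS⟩ := this
  rw [Finset.mem_image] at hn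
  obtain ⟨i, hi, rfl⟩ := hn
  have h5 : T * i ≤ T * S.card := Nat.mul_le_mul_left _ (by simp at hi; omega)
  refine ⟨φ i, by simp only [φ]; omega, by simp only [φ]; omega, hnS, ?_⟩
  refine ⟨i - (a - 1) / T, ?_⟩
  simp only [φ]
  push_cast
  rw [h3]
  linear_combination h4

set_option maxHeartbeats 2000000 in
/-- The contradiction: too few bad points is impossible. -/
lemma core (r : ℕ) (hr : 1 ≤ r) (P : Polynomial ℚ) (hPdeg : P.natDegree = r)
    (hPlc : 0 < P.leadingCoeff)
    (f : ℤ → ℤ) (hfP : ∀ ℓ : ℤ, (f ℓ : ℚ) = P.eval (ℓ : ℚ))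
    (Pif : ℕ) (hPifpos : 0 < Pif)
    (hPif : ∀ d : ℕ, d ∣ Pif ↔ ∀ ℓ : ℤ, (d : ℤ) ∣ (f ℓ - f 0)) :
    ∃ (e : ℝ) (W M : ℕ), 0 < e ∧ 0 < W ∧ 0 < M ∧
      ∀ δ k j L : ℕ, 0 < δ → δ ∣ Pif → 1 ≤ j → j < k →
        (∀ p : ℕ, p.Prime → p ∣ k → ¬ (p * δ ∣ Pif)) →
        ∀ ℓ : ℤ, ∀ y : ℝ, M ≤ L → ∀ S : Finset ℕ,
          (∀ n : ℕ, 1 ≤ n → n ≤ L → n ∉ S → NearInt ((((k : ℤ) * ℓ + j : ℤ) : ℝ) / ((δ : ℝ) * (k : ℝ)) -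
                  (f (n : ℤ) : ℝ) * y) (e / k)) → L ≤ W * S.card := by
  classical
  set PR : Polynomial ℝ := P.map (algebraMap ℚ ℝ) with hPR
  have hPRdeg : PR.natDegree ≤ r := by
    rw [← hPdeg]; exact Polynomial.natDegree_map_le
  have hfR : ∀ n : ℕ, PR.eval (n : ℝ) = f n := by
    intro n
    have h1 : PR.eval ((algebraMap ℚ ℝ) (n : ℚ)) = algebraMap ℚ ℝ (P.eval (n : ℚ)) :=
      Polynomial.eval_map_apply _ _
    have h2 := hfP n
    rw [Int.cast_natCast] at h2
    rw [← h2] at h1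
    simpa using h1
  obtain ⟨F, hF0, hF⟩ := growth r PR hPRdeg
  set q : ℚ := r.factorial * P.leadingCoeff with hq
  have hq0 : 0 < q := by positivity
  obtain ⟨A, hAq⟩ : ∃ A : ℕ, q.num = A := ⟨q.num.toNat, by
    have := Rat.num_pos.mpr hq0; omega⟩
  have hA : 0 < A := by have := Rat.num_pos.mpr hq0; omega
  set B : ℕ := q.den with hBdef
  have hB : 0 < B := q.den_pos
  have hA' : (0 : ℝ) < A := by exact_mod_cast hA
  have hA1 : (1 : ℝ) ≤ A := by exact_mod_cast hA
  have hB' : (0 : ℝ) < B := by exact_mod_cast hB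
  have hPif1 : (1 : ℝ) ≤ Pif := by exact_mod_cast hPifpos
  have hr' : (1 : ℝ) ≤ r := by exact_mod_cast hr
  have hqAB : (B : ℝ) * (r.factorial * PR.coeff r) = A := by
    have h1 : q * B = A := by
      have := Rat.mul_den_eq_num q
      rw [hAq] at this
      exact_mod_cast this
    have h2 : PR.coeff r = ((P.leadingCoeff : ℚ) : ℝ) := by
      rw [hPR, Polynomial.coeff_map, Polynomial.leadingCoeff, hPdeg]; rfl
    rw [h2]
    have h3 : ((q * B : ℚ) : ℝ) = ((A : ℚ) : ℝ) := by rw [h1]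
    rw [hq] at h3
    push_cast at h3
    linarith
  obtain ⟨T, hT, hper⟩ := exists_period P f hfP A hA
  set C1 : ℝ := F * (B * 2 ^ r * (8 * r) ^ r) with hC1
  have hC10 : 0 ≤ C1 := by positivity
  set C2 : ℝ := 1 + C1 with hC2
  have hC21 : 1 ≤ C2 := by linarith
  set e : ℝ := 1 / (4 * 2 ^ r * C2 * A * Pif) with he
  have he0 : 0 < e := by positivity
  have hemul : e * (4 * 2 ^ r * C2 * A * Pif) = 1 := by
    rw [he]; field_simp
  have h2r : (1 : ℝ) ≤ 2 ^ r := one_le_pow₀ (by norm_num)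
  have he1 : 2 ^ r * e < 1 / 3 := by
    have : 1 ≤ C2 * A * Pif := one_le_mul_of_one_le_of_one_le
      (one_le_mul_of_one_le_of_one_le hC21 hA1) hPif1
    have : 2 ^ r * e * 1 ≤ 2 ^ r * e * (C2 * A * Pif) := by gcongr
    nlinarith
  have he2 : A * (2 * (C2 * e)) < 1 := by
    have : 1 ≤ 2 ^ r * (Pif : ℝ) := one_le_mul_of_one_le_of_one_le h2r hPif1
    have : A * C2 * e * 1 ≤ A * C2 * e * (2 ^ r * Pif) := by gcongr
    nlinarith
  have he3 : Pif * (C2 * e) < 1 := by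
    have : 1 ≤ 2 ^ r * (A : ℝ) := one_le_mul_of_one_le_of_one_le h2r hA1
    have : Pif * C2 * e * 1 ≤ Pif * C2 * e * (2 ^ r * A) := by gcongr
    nlinarith
  refine ⟨e, 4 * 2 ^ r * T, 4 * r + 2 * T, he0, by positivity, by positivity, ?_⟩
  intro δ k j L hδ hδP hj hjk hcop ℓ y hML S hS
  by_contra hcon
  push Not at hcon
  have hk : 0 < k := by omega
  have hk' : (0 : ℝ) < k := by exact_mod_cast hk
  have hk1 : (1 : ℝ) ≤ k := by exact_mod_cast hk
  have hδ' : (0 : ℝ) < δ := by exact_mod_cast hδ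
  have hL : 0 < L := by omega
  have hL' : (0 : ℝ) < L := by exact_mod_cast hL
  set θ : ℝ := (((k : ℤ) * ℓ + j : ℤ) : ℝ) / ((δ : ℝ) * (k : ℝ)) with hθ
  set e1 : ℝ := e / k with he1def
  have he10 : 0 < e1 := by positivity
  have he1e : e1 ≤ e := div_le_self he0.le hk1
  -- Weyl differencing
  set K : ℕ := L / (4 * r) with hK
  have hK1 : 1 ≤ K := by
    rw [hK, Nat.one_le_div_iff (by omega)]; omega
  have hKL : K * (4 * r) ≤ L := Nat.div_mul_le_self _ _
  have hKL2 : L < (K + 1) * (4 * r) := by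
    have := Nat.lt_mul_div_succ L (show 0 < 4 * r by omega)
    rw [← hK] at this
    linarith
  have hKL3 : (L : ℝ) ≤ K * (8 * r) := by
    have : L ≤ K * (8 * r) := by nlinarith
    exact_mod_cast this
  have hK' : (0 : ℝ) < K := by exact_mod_cast hK1
  obtain ⟨m, hm⟩ : ∃ m : ℤ, |A * y - m| ≤ B * (2 ^ r * e1 / K ^ r) := by
    set g : Polynomial ℝ := Polynomial.C θ - Polynomial.C y * PR with hg
    have hgdeg : g.natDegree ≤ r := by
      refine (Polynomial.natDegree_sub_le _ _).trans ?_
      rw [Polynomial.natDegree_C]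
      exact max_le (by omega) ((Polynomial.natDegree_C_mul_le _ _).trans hPRdeg)
    have := weyl r g hgdeg L S.card K e1 he10.le (lt_of_le_of_lt (by gcongr) he1) hK1 (by
      have : 2 ^ r * S.card * 1 ≤ 2 ^ r * S.card * T := Nat.mul_le_mul_left _ hT
      nlinarith) (Finset.card_le_card (by
        intro n hn
        rw [Finset.mem_filter, Finset.mem_Icc] at hn
        by_contra hnS
        apply hn.2
        have := hS n hn.1.1 hn.1.2 hnS
        rw [hg]
        simp only [Polynomial.eval_sub, Polynomial.eval_mul, Polynomial.eval_C, hfR]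
        rwa [mul_comm y]))
    have hgc : g.coeff r = - (y * PR.coeff r) := by
      rw [hg, Polynomial.coeff_sub, Polynomial.coeff_C_mul, Polynomial.coeff_C, if_neg (by omega)]
      ring
    obtain ⟨m, hm⟩ := this
    refine ⟨-(B * m), ?_⟩
    have : A * y - ((-(B * m) : ℤ) : ℝ) = -(B * (r.factorial * g.coeff r - m)) := by
      rw [hgc, ← hqAB]; push_cast; ring
    rw [this, abs_neg, abs_mul, abs_of_pos hB']
    gcongr
  -- replace y by m / A
  have hfy : ∀ n : ℕ, 1 ≤ n → n ≤ L → |(f n : ℝ) * y - f n * m / A| ≤ C1 * e1 := by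
    intro n hn hnL
    have h1 := hF n L hn hnL
    rw [hfR] at h1
    have h2 : (f n : ℝ) * y - f n * m / A = f n * (A * y - m) / A := by field_simp
    rw [h2, abs_div, abs_mul, abs_of_pos hA']
    refine (div_le_self (by positivity) hA1).trans ?_
    have h3 : (L : ℝ) ^ r ≤ K ^ r * (8 * r) ^ r := by
      rw [← mul_pow]; exact pow_le_pow_left₀ hL'.le hKL3 r
    calc |(f n : ℝ)| * |A * y - m| ≤ (F * (L : ℝ) ^ r) * (B * (2 ^ r * e1 / K ^ r)) := by gcongr
      _ ≤ (F * (K ^ r * (8 * r) ^ r)) * (B * (2 ^ r * e1 / K ^ r)) := by gcongr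
      _ = C1 * e1 := by rw [hC1]; field_simp
  have hall : ∀ a : ℤ, NearInt (θ - f a * m / A) (C2 * e1) := by
    intro a
    obtain ⟨n, hn1, hnL, hnS, hna⟩ := exists_good T L hT S (by
      have : T * S.card * 1 ≤ T * S.card * 2 ^ r := Nat.mul_le_mul_left _ Nat.one_le_two_pow
      nlinarith) a
    obtain ⟨u, hu⟩ := hS n hn1 hnL hnS
    obtain ⟨v, hv⟩ := hper n a hna
    have h1 := hfy n hn1 hnL
    refine ⟨u + v * m, ?_⟩
    have hv' : (f n : ℝ) = f a + A * v := by
      have : f n = f a + A * v := by omega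
      rw [this]; push_cast; ring
    have h2 : θ - f a * m / A - ((u + v * m : ℤ) : ℝ) =
        (θ - f n * y - u) + (f n * y - f n * m / A) := by
      push_cast; rw [hv']; field_simp; ring
    rw [h2]
    refine (abs_add_le _ _).trans ?_
    rw [hC2]; linarith
  have hdiv : ∀ a : ℤ, (A : ℤ) ∣ (f a - f 0) * m := by
    intro a
    apply dvd_of_near A hA _ (2 * (C2 * e1))
    · refine lt_of_le_of_lt ?_ he2
      gcongr
    · convert (hall 0).sub (hall a) using 1
      push_cast; ring
  have hAPm : (A : ℤ) ∣ Pif * m := by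
    set d := Int.gcd A m with hd
    have hd0 : 0 < d := Int.gcd_pos_of_ne_zero_left _ (by omega)
    obtain ⟨A', hA'd⟩ : d ∣ A := by
      have : (d : ℤ) ∣ A := Int.gcd_dvd_left ..
      exact_mod_cast this
    obtain ⟨m', hm'd⟩ : (d : ℤ) ∣ m := Int.gcd_dvd_right ..
    have hcop' : IsCoprime (A' : ℤ) m' := by
      rw [Int.isCoprime_iff_gcd_eq_one]
      have h1 : d = d * Int.gcd A' m' := by
        conv_lhs => rw [hd, hA'd, hm'd]
        push_cast
        rw [Int.gcd_mul_left]; simp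
      exact (Nat.eq_of_mul_eq_mul_left hd0 (by linarith)).symm
    have h1 : A' ∣ Pif := by
      rw [hPif]
      intro a
      have h2 := hdiv a
      rw [hA'd, hm'd] at h2
      push_cast at h2
      have h3 : (d : ℤ) * A' ∣ d * ((f a - f 0) * m') := by
        convert h2 using 1; ring
      exact hcop'.dvd_of_dvd_mul_right (Int.dvd_of_mul_dvd_mul_left (by omega) h3)
    obtain ⟨s, hs⟩ := h1
    refine ⟨s * m', ?_⟩
    rw [hs, hm'd, hA'd]; push_cast; ring
  -- final
  obtain ⟨w, hw⟩ := hAPm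
  obtain ⟨E, hE⟩ := hδP
  have hkdvd : (k : ℤ) ∣ E * (k * ℓ + j) := by
    apply dvd_of_near k hk _ (Pif * (C2 * e1))
    · calc (k : ℝ) * (Pif * (C2 * e1)) = Pif * (C2 * e) := by rw [he1def]; field_simp
        _ < 1 := he3
    · obtain ⟨u, hu⟩ := hall 0
      refine ⟨Pif * u + f 0 * w, ?_⟩
      have hw' : (Pif : ℝ) * m = A * w := by exact_mod_cast hw
      have hE' : (Pif : ℝ) = δ * E := by exact_mod_cast hE
      have : ((E * (k * ℓ + j) : ℤ) : ℝ) / k - ((Pif * u + f 0 * w : ℤ) : ℝ) =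
          Pif * (θ - f 0 * m / A - u) := by
        have h1 : (w : ℝ) = Pif * m / A := by rw [hw']; field_simp
        have h2 : ((E * (k * ℓ + j) : ℤ) : ℝ) / k = Pif * θ := by
          rw [hθ, hE']; push_cast; field_simp
        rw [h2]; push_cast; rw [h1]; ring
      rw [this, abs_mul, abs_of_pos (by linarith)]
      gcongr
  have hkE : Nat.Coprime k E := by
    rw [Nat.coprime_iff_gcd_eq_one]
    by_contra hne
    obtain ⟨p, hp, hpd⟩ := Nat.exists_prime_and_dvd hne
    apply hcop p hp (hpd.trans (Nat.gcd_dvd_left _ _))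
    rw [hE, mul_comm δ E]
    exact Nat.mul_dvd_mul_right (hpd.trans (Nat.gcd_dvd_right _ _)) δ
  have hk2 : (k : ℤ) ∣ E * j := by
    have : (E : ℤ) * j = E * (k * ℓ + j) - k * (E * ℓ) := by ring
    rw [this]
    exact dvd_sub hkdvd (dvd_mul_right _ _)
  have hk3 : k ∣ E * j := by exact_mod_cast hk2
  have := Nat.le_of_dvd (by omega) (hkE.dvd_of_dvd_mul_left hk3)
  omega

theorem stmt10 (r : ℕ) (hr : 1 ≤ r) (P : Polynomial ℚ) (hPdeg : P.natDegree = r)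
    (hPlc : 0 < P.leadingCoeff)
    (f : ℤ → ℤ) (hfP : ∀ ℓ : ℤ, (f ℓ : ℚ) = P.eval (ℓ : ℚ))
    (hfpos : ∀ ℓ : ℤ, 1 ≤ ℓ → 0 < f ℓ)
    (hfprime : ∀ p : ℕ, p.Prime → ∃ ℓ : ℤ, ¬ ((p : ℤ) ∣ f ℓ))
    (Pif : ℕ) (hPifpos : 0 < Pif)
    (hPif : ∀ d : ℕ, d ∣ Pif ↔ ∀ ℓ : ℤ, (d : ℤ) ∣ (f ℓ - f 0)) :
    ∃ c M : ℝ, 0 < c ∧ 0 < M ∧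
      ∀ δ k j L : ℕ, 0 < δ → δ ∣ Pif → 0 < L → 1 ≤ j → j < k →
        (∀ p : ℕ, p.Prime → p ∣ k → ¬ (p * δ ∣ Pif)) →
        ∀ ℓ : ℤ, ∀ y : ℝ, M ≤ (L : ℝ) / (k : ℝ) ^ 2 →
          c * (L : ℝ) / (k : ℝ) ^ 2 ≤
            (∑ n ∈ Finset.Icc 1 L,
              (1 - Complex.exp (2 * Real.pi * Complex.I *
                ((((k : ℤ) * ℓ + j : ℤ) : ℝ) / ((δ : ℝ) * (k : ℝ)) -
                  (f (n : ℤ) : ℝ) * y : ℝ)))).re := by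
  classical
  obtain ⟨e, W, M, he, hW, hM, hmain⟩ := core r hr P hPdeg hPlc f hfP Pif hPifpos hPif
  have hW' : (0 : ℝ) < W := by exact_mod_cast hW
  refine ⟨8 * e ^ 2 / W, M, by positivity, by exact_mod_cast hM, ?_⟩
  intro δ k j L hδ hδP hL hj hjk hcop ℓ y hML
  have hk : 0 < k := by omega
  have hk' : (0 : ℝ) < k := by exact_mod_cast hk
  have hk1 : (1 : ℝ) ≤ (k : ℝ) ^ 2 := one_le_pow₀ (by exact_mod_cast hk)
  have hML' : M ≤ L := by
    have : (M : ℝ) ≤ L := hML.trans (div_le_self (by positivity) hk1)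
    exact_mod_cast this
  set φ : ℕ → ℝ := fun n => (((k : ℤ) * ℓ + j : ℤ) : ℝ) / ((δ : ℝ) * (k : ℝ)) -
                  (f (n : ℤ) : ℝ) * y with hφ
  set S := (Finset.Icc 1 L).filter (fun n => ¬ NearInt (φ n) (e / k)) with hS
  have hcard : L ≤ W * S.card := by
    apply hmain δ k j L hδ hδP hj hjk hcop ℓ y hML' S
    intro n h1 h2 h3
    by_contra h4
    apply h3
    rw [hS, Finset.mem_filter, Finset.mem_Icc]
    exact ⟨⟨h1, h2⟩, h4⟩
  have hcard' : (L : ℝ) ≤ W * S.card := by exact_mod_cast hcard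
  have hterm : ∀ n : ℕ, (1 - Complex.exp (2 * Real.pi * Complex.I * (φ n : ℝ))).re =
      1 - Real.cos (2 * Real.pi * φ n) := by
    intro n
    have : (2 * Real.pi * Complex.I * (φ n : ℝ) : ℂ) = ((2 * Real.pi * φ n : ℝ) : ℂ) * Complex.I := by
      push_cast; ring
    rw [this, Complex.sub_re, Complex.exp_ofReal_mul_I_re, Complex.one_re]
  rw [Complex.re_sum]
  calc 8 * e ^ 2 / W * L / (k : ℝ) ^ 2 ≤ 8 * e ^ 2 / W * (W * S.card) / (k : ℝ) ^ 2 := by gcongr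
    _ = ∑ n ∈ S, 8 * (e / k) ^ 2 := by
      rw [Finset.sum_const, nsmul_eq_mul]; field_simp
    _ ≤ ∑ n ∈ S, (1 - Real.cos (2 * Real.pi * φ n)) := by
      apply Finset.sum_le_sum
      intro n hn
      rw [hS, Finset.mem_filter] at hn
      exact one_sub_cos_ge _ _ (by positivity) hn.2
    _ ≤ ∑ n ∈ Finset.Icc 1 L, (1 - Real.cos (2 * Real.pi * φ n)) := by
      apply Finset.sum_le_sum_of_subset_of_nonneg (Finset.filter_subset _ _)
      intro n _ _
      linarith [Real.cos_le_one (2 * Real.pi * φ n)]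
    _ = _ := by
      apply Finset.sum_congr rfl
      intro n _
      rw [← hterm n]
end

section
/- Let a_r > 0 denote the leading coefficient of P. Suppose that for each positive integer n, x(n) > 0 satisfies Σ_{ℓ ≥ 1} f(ℓ)/(e^{f(ℓ)·x(n)} − 1) = n. Then n · x(n)^{(r+1)/r} → ζ(1 + 1/r)·Γ(1 + 1/r)/(r · a_r^{1/r}) as n → ∞; in particular x(n) ∼ (c₁/n)^{r/(r+1)} with c₁ := ζ(1 + 1/r)·Γ(1 + 1/r)/(r·a_r^{1/r}). -/
open Real Set Filter Topology MeasureTheory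

noncomputable def gB (u : ℝ) : ℝ := u / (Real.exp u - 1)

lemma gB_meas : Measurable gB := by unfold gB; fun_prop

lemma gB_nonneg {u : ℝ} (hu : 0 < u) : 0 ≤ gB u := by
  have := Real.one_lt_exp_iff.2 hu
  exact div_nonneg hu.le (by linarith)

lemma gB_anti {u v : ℝ} (hu : 0 < u) (huv : u ≤ v) : gB v ≤ gB u := by
  have h := convexOn_exp.secant_mono (a := 0) (x := u) (y := v) (mem_univ _) (mem_univ _)
    (mem_univ _) hu.ne' (hu.trans_le huv).ne' huv
  simp only [Real.exp_zero, sub_zero] at h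
  have h1 := Real.one_lt_exp_iff.2 hu
  have h3 : 0 < (rexp u - 1) / u := div_pos (by linarith) hu
  have := inv_anti₀ h3 h
  rwa [inv_div, inv_div] at this

lemma gB_cont {u : ℝ} (hu : 0 < u) : ContinuousAt gB u := by
  unfold gB
  have h1 := Real.one_lt_exp_iff.2 hu
  refine ContinuousAt.div (by fun_prop) (by fun_prop) (by linarith)

lemma zeta_real {s : ℝ} (hs : 1 < s) :
    HasSum (fun n : ℕ => 1 / ((n : ℝ) + 1) ^ s) (riemannZeta (s : ℂ)).re ∧
    riemannZeta (s : ℂ) = ((riemannZeta (s : ℂ)).re : ℂ) ∧ 0 < (riemannZeta (s : ℂ)).re := by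
  have hsum : Summable (fun n : ℕ => 1 / ((n : ℝ) + 1) ^ s) := by
    have := (summable_nat_add_iff 1).2 (Real.summable_one_div_nat_rpow.2 hs)
    simpa using this
  have h1 : riemannZeta (s : ℂ) = ((∑' n : ℕ, 1 / ((n : ℝ) + 1) ^ s : ℝ) : ℂ) := by
    rw [zeta_eq_tsum_one_div_nat_add_one_cpow (by simpa using hs), Complex.ofReal_tsum]
    congr 1; ext n
    rw [Complex.ofReal_div, Complex.ofReal_cpow (by positivity)]
    simp
  have h2 : (riemannZeta (s : ℂ)).re = ∑' n : ℕ, 1 / ((n : ℝ) + 1) ^ s := by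
    rw [h1, Complex.ofReal_re]
  refine ⟨h2 ▸ hsum.hasSum, by rw [h2]; exact h1, ?_⟩
  rw [h2]
  exact hsum.tsum_pos (fun n => by positivity) 0 (by norm_num)

lemma exp_geom {u : ℝ} (hu : 0 < u) :
    HasSum (fun i : ℕ => rexp (-(((i : ℝ) + 1) * u))) (1 / (rexp u - 1)) := by
  have h := (hasSum_geometric_of_lt_one (Real.exp_pos (-u)).le
    (by rw [Real.exp_lt_one_iff]; linarith : rexp (-u) < 1)).mul_left (rexp (-u))
  convert! h using 1
  · ext i
    rw [← Real.exp_nat_mul, ← Real.exp_add]; congr 1; ring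
  · have h1 := Real.one_lt_exp_iff.2 hu
    rw [Real.exp_neg]
    have : rexp u - 1 ≠ 0 := by linarith
    have h3 : 1 - (rexp u)⁻¹ ≠ 0 := by
      have := inv_lt_one_of_one_lt₀ h1
      linarith
    field_simp

lemma bose {s a : ℝ} (hs : 1 < s) (ha : 0 < a) :
    ∫ t in Ioi (0:ℝ), t ^ (s - 1) * (1 / (rexp (a * t) - 1)) =
      Real.Gamma s * (riemannZeta (s : ℂ)).re / a ^ s := by
  obtain ⟨hz, hz2, hz3⟩ := zeta_real hs
  have hM := hasSum_mellin (ι := ℕ) (a := fun _ => 1) (p := fun i => ((i : ℝ) + 1) * a)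
    (F := fun t => ((1 / (rexp (a * t) - 1) : ℝ) : ℂ)) (s := (s : ℂ))
    (fun i => Or.inr (by positivity)) (by simp; linarith)
    (by
      intro t ht
      have := Complex.hasSum_ofReal.2 (exp_geom (mul_pos ha ht))
      convert! this using 1
      ext i
      simp only [one_mul]
      congr 2; ring)
    (by
      have := hz.summable.mul_right (1 / a ^ s)
      convert! this using 1
      ext i
      simp only [norm_one, Complex.ofReal_re]
      rw [Real.mul_rpow (by positivity) ha.le]
      field_simp)
  have h2 : HasSum (fun i : ℕ => Complex.Gamma s * 1 / (((((i : ℝ) + 1) * a : ℝ)) : ℂ) ^ (s : ℂ))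
      ((Real.Gamma s * (riemannZeta (s : ℂ)).re / a ^ s : ℝ) : ℂ) := by
    have := Complex.hasSum_ofReal.2 (hz.mul_left (Real.Gamma s / a ^ s))
    convert! this using 1
    · ext i
      rw [← Complex.ofReal_cpow (by positivity), Real.mul_rpow (by positivity) ha.le,
        Complex.Gamma_ofReal]
      push_cast
      field_simp
    · congr 1; ring
  have h3 := hM.unique h2
  rw [mellin] at h3
  have h4 : (∫ t in Ioi (0:ℝ), (t : ℂ) ^ ((s : ℂ) - 1) • ((1 / (rexp (a * t) - 1) : ℝ) : ℂ)) =
      ∫ t in Ioi (0:ℝ), ((t ^ (s - 1) * (1 / (rexp (a * t) - 1)) : ℝ) : ℂ) := by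
    refine setIntegral_congr_fun measurableSet_Ioi fun t ht => ?_
    have ht : (0:ℝ) < t := ht
    simp only [smul_eq_mul]
    rw [Complex.ofReal_mul, Complex.ofReal_cpow ht.le]
    simp
  rw [h4, integral_complex_ofReal] at h3
  exact_mod_cast h3

lemma int_gB {r : ℕ} (hr : 1 ≤ r) {a : ℝ} (ha : 0 < a) :
    ∫ t in Ioi (0:ℝ), gB (a * t ^ r) =
      (riemannZeta (1 + 1 / (r : ℂ))).re * Real.Gamma (1 + 1 / (r : ℝ)) /
          ((r : ℝ) * a ^ ((1 : ℝ) / r)) := by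
  have hr0 : (0:ℝ) < r := by exact_mod_cast hr
  have hb := bose (s := 1 + 1 / (r : ℝ)) (a := a) (by simp; omega) ha
  rw [← integral_comp_rpow_Ioi_of_pos (g := fun t => gB (a * t ^ r)) (p := 1 / (r:ℝ)) (by positivity)]
  have : ∫ x in Ioi (0:ℝ), ((1 / (r:ℝ)) * x ^ (1 / (r:ℝ) - 1)) • gB (a * (x ^ (1 / (r:ℝ))) ^ r)
     = ∫ x in Ioi (0:ℝ), (a / r) * (x ^ ((1 + 1 / (r : ℝ)) - 1) * (1 / (rexp (a * x) - 1))) := by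
    refine setIntegral_congr_fun measurableSet_Ioi fun t ht => ?_
    have ht : (0:ℝ) < t := ht
    have e1 : (t ^ (1 / (r:ℝ))) ^ r = t := by
      rw [one_div]; exact Real.rpow_inv_natCast_pow ht.le (by omega)
    have e2 : t ^ (1 / (r:ℝ) - 1) = t ^ (1 / (r:ℝ)) / t := by
      rw [Real.rpow_sub ht, Real.rpow_one]
    simp only [smul_eq_mul, e1, e2, gB, add_sub_cancel_left]
    field_simp
  rw [this, integral_const_mul, hb, Real.rpow_add ha, Real.rpow_one]
  push_cast
  field_simp

lemma const_pos {r : ℕ} (hr : 1 ≤ r) {a : ℝ} (ha : 0 < a) : 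
    0 < (riemannZeta (1 + 1 / (r : ℂ))).re * Real.Gamma (1 + 1 / (r : ℝ)) /
          ((r : ℝ) * a ^ ((1 : ℝ) / r)) := by
  have hr0 : (0:ℝ) < r := by exact_mod_cast hr
  have hz := (zeta_real (s := 1 + 1 / (r:ℝ)) (by simp; omega)).2.2
  push_cast at hz
  have := Real.Gamma_pos_of_pos (s := 1 + 1 / (r:ℝ)) (by positivity)
  positivity

lemma int_ceil (H : ℕ → ℝ) (hH : IntegrableOn (fun t : ℝ => H ⌈t⌉₊) (Ioi 0)) :
    ∫ t in Ioi (0:ℝ), H ⌈t⌉₊ = ∑' l : ℕ, H (l + 1) := by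
  have hU : Ioi (0:ℝ) = ⋃ n : ℕ, Ioc (n : ℝ) (n + 1) := by
    ext t
    simp only [mem_Ioi, mem_iUnion, mem_Ioc]
    constructor
    · intro ht
      have h1 : 0 < ⌈t⌉₊ := Nat.ceil_pos.2 ht
      refine ⟨⌈t⌉₊ - 1, Nat.lt_ceil.1 (by omega), ?_⟩
      have := Nat.le_ceil t
      rw [Nat.cast_sub h1]
      push_cast; linarith
    · rintro ⟨n, h1, -⟩
      exact lt_of_le_of_lt (by positivity) h1
  have hc : ∀ (n : ℕ), ∀ t ∈ Ioc (n:ℝ) (n+1), ⌈t⌉₊ = n + 1 := by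
    intro n t ht
    rw [Nat.ceil_eq_iff (by omega)]
    simpa using ht
  rw [hU] at hH ⊢
  rw [integral_iUnion (fun _ => measurableSet_Ioc) _ hH]
  · congr 1; ext n
    rw [setIntegral_congr_fun (g := fun _ => H (n+1)) measurableSet_Ioc
      (fun t ht => by simp only [hc n t ht])]
    simp
  · intro m n hmn
    rw [Function.onFun, Set.disjoint_left]
    intro t h1 h2
    have := hc m t h1
    have := hc n t h2
    omega

lemma int_ceil' (H : ℕ → ℝ) {R : ℝ} (hR : 0 < R)
    (hH : IntegrableOn (fun t : ℝ => H ⌈t * R⌉₊) (Ioi 0)) :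
    ∫ t in Ioi (0:ℝ), H ⌈t * R⌉₊ = R⁻¹ * ∑' l : ℕ, H (l + 1) := by
  have h1 := (integrableOn_Ioi_comp_mul_left_iff (fun t : ℝ => H ⌈t⌉₊) 0 hR).1
    (by simpa only [mul_comm R] using hH)
  have h2 := integral_comp_mul_left_Ioi (fun t : ℝ => H ⌈t⌉₊) 0 hR
  rw [mul_zero] at h1 h2
  rw [int_ceil H h1] at h2
  simpa only [mul_comm R, smul_eq_mul] using h2

lemma step_integrable {r : ℕ} (hr : 1 ≤ r) {φ : ℕ → ℝ} {c : ℝ} (hc : 0 < c)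
    (hφ : ∀ m : ℕ, 1 ≤ m → c * (m:ℝ) ^ r ≤ φ m) {R : ℝ} (hR : 0 < R) :
    Measurable (fun t : ℝ => gB (φ ⌈t * R⌉₊ / R ^ r)) ∧
    (∀ t : ℝ, 0 < t → ‖gB (φ ⌈t * R⌉₊ / R ^ r)‖ ≤ gB (c * t ^ r)) ∧
    IntegrableOn (fun t : ℝ => gB (c * t ^ r)) (Ioi 0) ∧
    IntegrableOn (fun t : ℝ => gB (φ ⌈t * R⌉₊ / R ^ r)) (Ioi 0) := by
  have hm : Measurable (fun t : ℝ => gB (φ ⌈t * R⌉₊ / R ^ r)) := by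
    have h1 : Measurable (fun t : ℝ => ⌈t * R⌉₊) := Nat.measurable_ceil.comp (by fun_prop)
    have h2 : Measurable φ := measurable_from_top
    exact gB_meas.comp ((h2.comp h1).div_const _)
  have hb : ∀ t : ℝ, 0 < t → ‖gB (φ ⌈t * R⌉₊ / R ^ r)‖ ≤ gB (c * t ^ r) := by
    intro t ht
    have h1 : 0 < ⌈t * R⌉₊ := Nat.ceil_pos.2 (by positivity)
    have h2 : c * t ^ r ≤ φ ⌈t * R⌉₊ / R ^ r := by
      rw [le_div_iff₀ (by positivity)]
      refine le_trans ?_ (hφ _ h1)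
      rw [mul_assoc, ← mul_pow]
      gcongr
      exact Nat.le_ceil _
    have h3 : 0 < c * t ^ r := by positivity
    rw [Real.norm_of_nonneg (gB_nonneg (h3.trans_le h2))]
    exact gB_anti h3 h2
  have hi : IntegrableOn (fun t : ℝ => gB (c * t ^ r)) (Ioi 0) := by
    apply Integrable.of_integral_ne_zero
    rw [int_gB hr hc]
    exact (const_pos hr hc).ne'
  refine ⟨hm, hb, hi, ?_⟩
  refine Integrable.mono' hi hm.aestronglyMeasurable ?_
  filter_upwards [ae_restrict_mem measurableSet_Ioi] with t ht using hb t ht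

lemma step_tendsto {r : ℕ} (hr : 1 ≤ r) {φ : ℕ → ℝ} {c a : ℝ} (hc : 0 < c) (ha : 0 < a)
    (hφ : ∀ m : ℕ, 1 ≤ m → c * (m:ℝ) ^ r ≤ φ m)
    (hlim : Tendsto (fun m : ℕ => φ m / (m:ℝ) ^ r) atTop (𝓝 a)) :
    Tendsto (fun R : ℝ => ∫ t in Ioi (0:ℝ), gB (φ ⌈t * R⌉₊ / R ^ r)) atTop
      (𝓝 (∫ t in Ioi (0:ℝ), gB (a * t ^ r))) := by
  refine tendsto_integral_filter_of_dominated_convergence (fun t => gB (c * t ^ r)) ?_ ?_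
    (step_integrable hr hc hφ one_pos).2.2.1 ?_
  · filter_upwards [eventually_gt_atTop 0] with R hR
    exact (step_integrable hr hc hφ hR).1.aestronglyMeasurable
  · filter_upwards [eventually_gt_atTop 0] with R hR
    filter_upwards [ae_restrict_mem measurableSet_Ioi] with t ht
    exact (step_integrable hr hc hφ hR).2.1 t ht
  · filter_upwards [ae_restrict_mem measurableSet_Ioi] with t ht
    have ht : (0:ℝ) < t := ht
    refine Tendsto.comp (gB_cont (by positivity)) ?_
    have h1 : Tendsto (fun R : ℝ => ⌈t * R⌉₊) atTop atTop :=
      tendsto_nat_ceil_atTop.comp (tendsto_id.const_mul_atTop ht)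
    have h2 := (hlim.comp h1).mul ((tendsto_nat_ceil_mul_div_atTop ht.le).pow r)
    refine h2.congr' ?_
    filter_upwards [eventually_gt_atTop 0] with R hR
    have h1 : 0 < ⌈t * R⌉₊ := Nat.ceil_pos.2 (by positivity)
    simp only [Function.comp]
    have : (0:ℝ) < (⌈t * R⌉₊ : ℝ) := by exact_mod_cast h1
    rw [div_pow]
    field_simp

theorem core_s18 {r : ℕ} (hr : 1 ≤ r) {φ : ℕ → ℝ} {a : ℝ} (ha : 0 < a)
    (hpos : ∀ m : ℕ, 1 ≤ m → 0 < φ m)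
    (hlim : Tendsto (fun m : ℕ => φ m / (m:ℝ) ^ r) atTop (𝓝 a))
    (x : ℕ → ℝ) (hxpos : ∀ n : ℕ, 1 ≤ n → 0 < x n)
    (hx : ∀ n : ℕ, 1 ≤ n → ∑' l : ℕ, φ (l + 1) / (rexp (φ (l + 1) * x n) - 1) = n) :
    Tendsto (fun n : ℕ => (n : ℝ) * x n ^ (((r : ℝ) + 1) / r)) atTop
      (𝓝 (∫ t in Ioi (0:ℝ), gB (a * t ^ r))) := by
  have hr0 : (0:ℝ) < r := by exact_mod_cast hr
  obtain ⟨c, hc, hφ⟩ : ∃ c : ℝ, 0 < c ∧ ∀ m : ℕ, 1 ≤ m → c * (m:ℝ) ^ r ≤ φ m := by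
    obtain ⟨M, hM⟩ := (hlim.inv₀ ha.ne').bddAbove_range
    refine ⟨(max M 1)⁻¹, by positivity, fun m hm => ?_⟩
    have h1 : (φ m / (m:ℝ) ^ r)⁻¹ ≤ max M 1 := (hM ⟨m, rfl⟩).trans (le_max_left _ _)
    have h2 := hpos m hm
    have h3 : (0:ℝ) < m := by exact_mod_cast hm
    rw [inv_div, div_le_iff₀ h2] at h1
    rwa [inv_mul_le_iff₀ (by positivity)]
  set R : ℕ → ℝ := fun n => x n ^ (-(1 / (r:ℝ))) with hRdef
  have hRpos : ∀ n, 1 ≤ n → 0 < R n := fun n hn => Real.rpow_pos_of_pos (hxpos n hn) _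
  have key : ∀ n : ℕ, 1 ≤ n → (n : ℝ) * x n ^ (((r : ℝ) + 1) / r) =
      ∫ t in Ioi (0:ℝ), gB (φ ⌈t * R n⌉₊ / R n ^ r) := by
    intro n hn
    have hxn := hxpos n hn
    have hRr : R n ^ r = (x n)⁻¹ := by
      rw [hRdef]
      simp only
      rw [← Real.rpow_natCast, ← Real.rpow_mul hxn.le, ← Real.rpow_neg_one]
      congr 1; field_simp
    rw [int_ceil' (fun m => gB (φ m / R n ^ r)) (hRpos n hn)
      (step_integrable hr hc hφ (hRpos n hn)).2.2.2]
    have : ∀ l : ℕ, gB (φ (l+1) / R n ^ r) =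
        x n * (φ (l + 1) / (rexp (φ (l + 1) * x n) - 1)) := by
      intro l
      rw [hRr, gB, div_inv_eq_mul]; ring
    simp only [this]
    rw [tsum_mul_left, hx n hn, hRdef]
    simp only
    rw [← Real.rpow_neg hxn.le, neg_neg,
      show ((r : ℝ) + 1) / r = 1 / r + 1 by field_simp; ring, Real.rpow_add hxn, Real.rpow_one]
    ring
  have hRlim : Tendsto R atTop atTop := by
    set C := ∫ t in Ioi (0:ℝ), gB (c * t ^ r) with hC
    have hCpos : 0 < C := by rw [hC, int_gB hr hc]; exact const_pos hr hc
    have hb : ∀ n : ℕ, 1 ≤ n → (n:ℝ) / C ≤ R n ^ ((r:ℝ) + 1) := by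
      intro n hn
      have hxn := hxpos n hn
      have h1 : (n : ℝ) * x n ^ (((r : ℝ) + 1) / r) ≤ C := by
        rw [key n hn]
        obtain ⟨h1, h2, h3, h4⟩ := step_integrable hr hc hφ (hRpos n hn)
        exact setIntegral_mono_on h4 h3 measurableSet_Ioi
          fun t ht => (le_abs_self _).trans (h2 t ht)
      have h2 : R n ^ ((r:ℝ) + 1) = (x n ^ (((r : ℝ) + 1) / r))⁻¹ := by
        rw [hRdef]
        simp only
        rw [← Real.rpow_mul hxn.le, ← Real.rpow_neg hxn.le]
        congr 1; ring
      have h3 : 0 < x n ^ (((r : ℝ) + 1) / r) := Real.rpow_pos_of_pos hxn _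
      rw [h2, div_le_iff₀ hCpos, inv_mul_eq_div, le_div_iff₀ h3]
      exact h1
    have h5 : Tendsto (fun n : ℕ => ((n:ℝ) / C) ^ (1 / ((r:ℝ) + 1))) atTop atTop :=
      (tendsto_rpow_atTop (by positivity)).comp
        (tendsto_natCast_atTop_atTop.atTop_div_const hCpos)
    refine tendsto_atTop_mono' _ ?_ h5
    filter_upwards [eventually_ge_atTop 1] with n hn
    calc ((n:ℝ) / C) ^ (1 / ((r:ℝ) + 1)) ≤ (R n ^ ((r:ℝ) + 1)) ^ (1 / ((r:ℝ) + 1)) :=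
          Real.rpow_le_rpow (by positivity) (hb n hn) (by positivity)
      _ = R n := by
        rw [← Real.rpow_mul (hRpos n hn).le, mul_one_div_cancel (by positivity), Real.rpow_one]
  refine ((step_tendsto hr hc ha hφ hlim).comp hRlim).congr' ?_
  filter_upwards [eventually_ge_atTop 1] with n hn
  exact (key n hn).symm

theorem stmt18 (r : ℕ) (hr : 1 ≤ r) (P : Polynomial ℚ) (hPdeg : P.natDegree = r)
    (hPlc : 0 < P.leadingCoeff)
    (f : ℤ → ℤ) (hfP : ∀ ℓ : ℤ, (f ℓ : ℚ) = P.eval (ℓ : ℚ))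
    (hfpos : ∀ ℓ : ℤ, 1 ≤ ℓ → 0 < f ℓ)
    (hfprime : ∀ p : ℕ, p.Prime → ∃ ℓ : ℤ, ¬ ((p : ℤ) ∣ f ℓ))
    (x : ℕ → ℝ) (hxpos : ∀ n : ℕ, 1 ≤ n → 0 < x n)
    (hx : ∀ n : ℕ, 1 ≤ n →
      ∑' ℓ : ℕ, (f ((ℓ : ℤ) + 1) : ℝ) / (Real.exp ((f ((ℓ : ℤ) + 1) : ℝ) * x n) - 1) = n) :
    Filter.Tendsto (fun n : ℕ => (n : ℝ) * x n ^ (((r : ℝ) + 1) / r))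
        Filter.atTop
        (nhds ((riemannZeta (1 + 1 / (r : ℂ))).re * Real.Gamma (1 + 1 / (r : ℝ)) /
          ((r : ℝ) * (P.leadingCoeff : ℝ) ^ ((1 : ℝ) / r)))) ∧
      Filter.Tendsto (fun n : ℕ =>
          x n / (((riemannZeta (1 + 1 / (r : ℂ))).re * Real.Gamma (1 + 1 / (r : ℝ)) /
              ((r : ℝ) * (P.leadingCoeff : ℝ) ^ ((1 : ℝ) / r))) / (n : ℝ)) ^
            ((r : ℝ) / ((r : ℝ) + 1)))
        Filter.atTop (nhds 1) := by
  have hr0 : (0:ℝ) < r := by exact_mod_cast hr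
  have ha : (0:ℝ) < (P.leadingCoeff : ℝ) := by exact_mod_cast hPlc
  have hP0 : P ≠ 0 := by rintro rfl; simp at hPlc
  have hev : ∀ m : ℕ, ((f (m:ℤ) : ℤ) : ℝ) = (P.map (algebraMap ℚ ℝ)).eval (m:ℝ) := by
    intro m
    have h := hfP m
    have h2 : ((f (m:ℤ) : ℚ) : ℝ) = ((P.eval ((m:ℤ):ℚ) : ℚ) : ℝ) := by rw [h]
    have h3 : ((m:ℝ)) = algebraMap ℚ ℝ (m:ℚ) := by simp
    rw [h3, Polynomial.eval_map_algebraMap, Polynomial.aeval_algebraMap_apply]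
    simpa using h2
  have hlim : Tendsto (fun m : ℕ => ((f (m:ℤ) : ℤ) : ℝ) / (m:ℝ) ^ r) atTop
      (𝓝 (P.leadingCoeff : ℝ)) := by
    have h := Polynomial.div_tendsto_atTop_leadingCoeff_div_of_degree_eq
      (P.map (algebraMap ℚ ℝ)) (Polynomial.X ^ r : Polynomial ℝ)
      (by rw [Polynomial.degree_map, Polynomial.degree_X_pow,
        Polynomial.degree_eq_natDegree hP0, hPdeg])
    simp only [Polynomial.leadingCoeff_map, Polynomial.leadingCoeff_X_pow, div_one,
      Polynomial.eval_pow, Polynomial.eval_X] at h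
    have h2 := h.comp tendsto_natCast_atTop_atTop
    simp only [hev]
    exact h2
  have h1 := core_s18 hr (φ := fun m : ℕ => ((f (m:ℤ) : ℤ) : ℝ)) ha
    (fun m hm => by exact_mod_cast hfpos m (by exact_mod_cast hm)) hlim x hxpos
    (by intro n hn; simpa using hx n hn)
  rw [int_gB hr ha] at h1
  refine ⟨h1, ?_⟩
  have hcp := const_pos hr ha
  set c := (riemannZeta (1 + 1 / (r : ℂ))).re * Real.Gamma (1 + 1 / (r : ℝ)) /
          ((r : ℝ) * (P.leadingCoeff : ℝ) ^ ((1 : ℝ) / r)) with hcdef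
  have h2 := (h1.div_const c).rpow_const (p := (r:ℝ) / (r + 1)) (Or.inr (by positivity))
  rw [div_self hcp.ne', Real.one_rpow] at h2
  refine h2.congr' ?_
  filter_upwards [eventually_ge_atTop 1] with n hn
  have hxn := hxpos n hn
  have hn0 : (0:ℝ) < n := by exact_mod_cast hn
  have e : (n:ℝ) * x n ^ (((r : ℝ) + 1) / r) / c = x n ^ (((r : ℝ) + 1) / r) / (c / n) := by
    field_simp
  rw [e, Real.div_rpow (by positivity) (by positivity), ← Real.rpow_mul hxn.le,
    div_mul_div_cancel₀ hr0.ne', div_self (by positivity), Real.rpow_one]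
end
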